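/- arXiv:2310.09697 — 3 statements merged into one kernel-verified Lean document; each statement's English description precedes it below -/
import Mathlib

section
/- Let D be a compact metric space, μ a Radon probability measure on D, and y ↦ A_y a continuous family of convex bodies in ℝ^n. Then |∫_D A_y dμ(y)|^{1/n} ≥ ∫_D |A_y|^{1/n} dμ(y), where |·| denotes n-dimensional Lebesgue measure. -/
open MeasureTheory Metric Set Filter
open scoped RealInnerProductSpace NNReal ENNReal Pointwise Topology

/-- The support function of a set `A ⊆ ℝⁿ`: `h_A(ξ) = sup_{ζ ∈ A} ⟨ζ, ξ⟩`. -/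
noncomputable def suppFn {n : ℕ} (A : Set (EuclideanSpace ℝ (Fin n)))
    (ξ : EuclideanSpace ℝ (Fin n)) : ℝ :=
  sSup ((fun ζ => ⟪ζ, ξ⟫) '' A)

lemma bm_one_compact {A B : Set ℝ} (hA : IsCompact A) (hB : IsCompact B) (hA' : A.Nonempty)
    (hB' : B.Nonempty) : volume A + volume B ≤ volume (A + B) := by
  obtain ⟨a, ha, ha'⟩ := hA.exists_isGreatest hA'
  obtain ⟨b, hb, hb'⟩ := hB.exists_isLeast hB'
  have h1 : volume ((fun x => x + b) '' A) = volume A := by simp [measure_preimage_add_right]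
  have h2 : volume ((fun x => a + x) '' B) = volume B := by simp [measure_preimage_add]
  have h3 : ((fun x => x + b) '' A) ∩ ((fun x => a + x) '' B) ⊆ {a + b} := by
    rintro _ ⟨⟨x, hx, rfl⟩, ⟨y, hy, hxy⟩⟩
    have := ha' hx
    have := hb' hy
    simp only at hxy
    simp only [mem_singleton_iff]
    linarith
  have h4 : volume (((fun x => x + b) '' A) ∩ ((fun x => a + x) '' B)) = 0 :=
    measure_mono_null h3 (by simp)
  have h5 := measure_union_add_inter (μ := volume) ((fun x => x + b) '' A)
    (t := (fun x => a + x) '' B) (hB.image (by fun_prop)).measurableSet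
  rw [h4, add_zero, h1, h2] at h5
  rw [← h5]
  apply measure_mono
  rintro _ (⟨x, hx, rfl⟩ | ⟨y, hy, rfl⟩)
  · exact add_mem_add hx hb
  · exact add_mem_add ha hy

lemma bm_one {A B C : Set ℝ} (hA : MeasurableSet A) (hB : MeasurableSet B) (hA' : A.Nonempty)
    (hB' : B.Nonempty) (hC : A + B ⊆ C) : volume A + volume B ≤ volume C := by
  refine le_trans ?_ (measure_mono hC)
  by_cases h0 : volume A = 0
  · obtain ⟨a, ha⟩ := hA'
    rw [h0, zero_add]
    have h2 : volume ((fun x => a + x) '' B) = volume B := by simp [measure_preimage_add]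
    rw [← h2]
    apply measure_mono
    rintro _ ⟨y, hy, rfl⟩
    exact add_mem_add ha hy
  by_cases h0' : volume B = 0
  · obtain ⟨b, hb⟩ := hB'
    rw [h0', add_zero]
    have h1 : volume ((fun x => x + b) '' A) = volume A := by simp [measure_preimage_add_right]
    rw [← h1]
    apply measure_mono
    rintro _ ⟨y, hy, rfl⟩
    exact add_mem_add hy hb
  refine le_of_forall_lt fun c hc => ?_
  obtain ⟨y, hy, z, hz, hyz⟩ := ENNReal.exists_lt_add_of_lt_add hc h0 h0'
  obtain ⟨A', hAA, hAc, hyA⟩ := hA.exists_lt_isCompact hy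
  obtain ⟨B', hBB, hBc, hzB⟩ := hB.exists_lt_isCompact hz
  have nA : A'.Nonempty := nonempty_of_measure_ne_zero (pos_of_gt hyA).ne'
  have nB : B'.Nonempty := nonempty_of_measure_ne_zero (pos_of_gt hzB).ne'
  calc c < y + z := hyz
    _ ≤ volume A' + volume B' := add_le_add hyA.le hzB.le
    _ ≤ volume (A' + B') := bm_one_compact hAc hBc nA nB
    _ ≤ _ := measure_mono (add_subset_add hAA hBB)

/-- layer cake on [0,1]. -/
lemma layer {f : ℝ → ℝ≥0∞} (hf : Measurable f) (h1 : ∀ x, f x ≤ 1) :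
    ∫⁻ x, f x = ∫⁻ l in Ioo (0:ℝ) 1, volume {x | ENNReal.ofReal l < f x} := by
  have e : ∀ x, f x = ENNReal.ofReal (f x).toReal := fun x =>
    (ENNReal.ofReal_toReal (ne_top_of_le_ne_top ENNReal.one_ne_top (h1 x))).symm
  have h := lintegral_eq_lintegral_meas_lt (volume : Measure ℝ) (f := fun x => (f x).toReal)
    (Eventually.of_forall fun x => ENNReal.toReal_nonneg) (hf.ennreal_toReal.aemeasurable)
  simp_rw [← e] at h
  rw [h]
  have : Ioi (0:ℝ) = Ioo 0 1 ∪ Ici 1 := by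
    ext x; simp only [mem_Ioi, mem_union, mem_Ioo, mem_Ici]; constructor
    · intro h; by_cases hx : x < 1 
      · exact Or.inl ⟨h, hx⟩
      · exact Or.inr (not_lt.1 hx)
    · rintro (h | h); exacts [h.1, by linarith]
  rw [this, lintegral_union measurableSet_Ici]
  · have z : ∫⁻ l in Ici (1:ℝ), volume {x | l < (f x).toReal} = 0 := by
      rw [setLIntegral_congr_fun (g := fun _ => 0) measurableSet_Ici]
      · simp
      · intro l hl
        convert measure_empty (μ := (volume : Measure ℝ))
        ext x
        simp only [mem_ofPred_eq, mem_empty_iff_false, iff_false, not_lt]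
        refine le_trans (ENNReal.toReal_mono ENNReal.one_ne_top (h1 x)) ?_
        simpa using hl
    rw [z, add_zero]
    refine setLIntegral_congr_fun measurableSet_Ioo fun l hl => ?_
    congr 1
    ext x
    exact (ENNReal.ofReal_lt_iff_lt_toReal hl.1.le (ne_top_of_le_ne_top ENNReal.one_ne_top (h1 x))).symm
  · rw [Set.disjoint_left]; rintro x hx hx'; exact absurd hx.2 (not_lt.2 hx')

lemma vol_smul_real {s : ℝ} (hs : 0 < s) (A : Set ℝ) : volume (s • A) = ENNReal.ofReal s * volume A := by
  rw [Measure.addHaar_smul]; simp [abs_of_pos hs]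

lemma pl_one_norm {s t : ℝ} (hs : 0 < s) (ht : 0 < t) (hst : s + t = 1) {f g h : ℝ → ℝ≥0∞}
    (hf : Measurable f) (hg : Measurable g) (hh : Measurable h)
    (f1 : ∀ x, f x ≤ 1) (g1 : ∀ x, g x ≤ 1)
    (fs : ∀ l < 1, ∃ x, l < f x) (gs : ∀ l < 1, ∃ x, l < g x)
    (H : ∀ x y, f x ^ s * g y ^ t ≤ h (s * x + t * y)) :
    ENNReal.ofReal s * (∫⁻ x, f x) + ENNReal.ofReal t * (∫⁻ x, g x) ≤ ∫⁻ x, h x := by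
  have hm : ∫⁻ x, min (h x) 1 ≤ ∫⁻ x, h x := lintegral_mono fun x => min_le_left _ _
  refine le_trans ?_ hm
  rw [layer hf f1, layer hg g1, layer (hh.min measurable_const) (fun x => min_le_right _ _)]
  have mm : ∀ f : ℝ → ℝ≥0∞, Measurable fun l : ℝ => volume {x | ENNReal.ofReal l < f x} := by
    intro f
    refine Antitone.measurable fun a b hab => measure_mono fun x hx => ?_
    exact lt_of_le_of_lt (ENNReal.ofReal_le_ofReal hab) hx
  rw [← lintegral_const_mul _ (mm f), ← lintegral_const_mul _ (mm g),
    ← lintegral_add_left ((mm f).const_mul _)]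
  refine setLIntegral_mono' measurableSet_Ioo fun l hl => ?_
  rw [← vol_smul_real hs, ← vol_smul_real ht]
  have l1 : ENNReal.ofReal l < 1 := by simpa using hl.2
  apply bm_one
  · exact (measurableSet_lt measurable_const hf).const_smul₀ s
  · exact (measurableSet_lt measurable_const hg).const_smul₀ t
  · exact Set.Nonempty.smul_set (s := {x | ENNReal.ofReal l < f x}) (fs _ l1)
  · exact Set.Nonempty.smul_set (s := {x | ENNReal.ofReal l < g x}) (gs _ l1)
  · rintro _ ⟨_, ⟨x, hx, rfl⟩, _, ⟨y, hy, rfl⟩, rfl⟩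
    simp only [mem_ofPred_eq, smul_eq_mul] at *
    refine lt_min (lt_of_lt_of_le ?_ (H x y)) l1
    calc ENNReal.ofReal l = ENNReal.ofReal l ^ s * ENNReal.ofReal l ^ t := by
          rw [← ENNReal.rpow_add _ _ (by simpa using hl.1) ENNReal.ofReal_ne_top, hst, ENNReal.rpow_one]
      _ < _ := ENNReal.mul_lt_mul (ENNReal.rpow_lt_rpow hx hs) (ENNReal.rpow_lt_rpow hy ht)

lemma amgm {s t : ℝ} (hs : 0 < s) (ht : 0 < t) (hst : s + t = 1) (a b : ℝ≥0∞) :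
    a ^ s * b ^ t ≤ ENNReal.ofReal s * a + ENNReal.ofReal t * b := by
  have hpq : (1/s).HolderConjugate (1/t) := by
    rw [Real.holderConjugate_iff]
    refine ⟨?_, by simpa using hst⟩
    rw [lt_div_iff₀ hs]; linarith
  have := ENNReal.young_inequality (a ^ s) (b ^ t) hpq
  rw [← ENNReal.rpow_mul, ← ENNReal.rpow_mul] at this
  rw [mul_one_div_cancel hs.ne', mul_one_div_cancel ht.ne'] at this
  simp only [ENNReal.rpow_one] at this
  refine this.trans (le_of_eq ?_)
  have e : ∀ r : ℝ, 0 < r → (ENNReal.ofReal (1 / r))⁻¹ = ENNReal.ofReal r := fun r hr => by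
    rw [← ENNReal.ofReal_inv_of_pos (by positivity)]; simp
  rw [ENNReal.div_eq_inv_mul, ENNReal.div_eq_inv_mul, e s hs, e t ht]

lemma pl_one_bdd {s t : ℝ} (hs : 0 < s) (ht : 0 < t) (hst : s + t = 1) {f g h : ℝ → ℝ≥0∞}
    (hf : Measurable f) (hg : Measurable g) (hh : Measurable h) (N : ℝ≥0∞) (hN : N ≠ ∞)
    (f1 : ∀ x, f x ≤ N) (g1 : ∀ x, g x ≤ N)
    (H : ∀ x y, f x ^ s * g y ^ t ≤ h (s * x + t * y)) :
    (∫⁻ x, f x) ^ s * (∫⁻ x, g x) ^ t ≤ ∫⁻ x, h x := by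
  set a := ⨆ x, f x with ha
  set b := ⨆ x, g x with hb
  have aT : a ≠ ∞ := ne_top_of_le_ne_top hN (iSup_le f1)
  have bT : b ≠ ∞ := ne_top_of_le_ne_top hN (iSup_le g1)
  by_cases a0 : a = 0
  · have : f = 0 := by ext x; exact le_antisymm ((le_iSup f x).trans a0.le) bot_le
    simp [this, hs]
  by_cases b0 : b = 0
  · have : g = 0 := by ext x; exact le_antisymm ((le_iSup g x).trans b0.le) bot_le
    simp [this, ht]
  set c := a ^ s * b ^ t with hc
  have ap : a ^ s ≠ 0 := by simp [a0, aT]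
  have bp : b ^ t ≠ 0 := by simp [b0, bT]
  have aq : a ^ s ≠ ∞ := by simp [a0, aT]
  have bq : b ^ t ≠ ∞ := by simp [b0, bT]
  have c0 : c ≠ 0 := mul_ne_zero ap bp
  have cT : c ≠ ∞ := ENNReal.mul_ne_top aq bq
  have ci : a⁻¹ ^ s * b⁻¹ ^ t = c⁻¹ := by
    rw [ENNReal.inv_rpow, ENNReal.inv_rpow, hc, ENNReal.mul_inv (Or.inl ap) (Or.inl aq)]
  have sup : ∀ (f : ℝ → ℝ≥0∞) (a : ℝ≥0∞), a = ⨆ x, f x → a ≠ 0 → a ≠ ∞ → 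
      ∀ l < 1, ∃ x, l < a⁻¹ * f x := by
    intro f a h h0 hT l hl
    have : a * l < ⨆ x, f x := by
      rw [← h]; simpa using (ENNReal.mul_lt_mul_iff_right h0 hT).2 hl
    obtain ⟨x, hx⟩ := lt_iSup_iff.1 this
    refine ⟨x, ?_⟩
    rw [← ENNReal.mul_lt_mul_iff_right h0 hT, ← mul_assoc, ENNReal.mul_inv_cancel h0 hT, one_mul]
    exact hx
  have key := pl_one_norm hs ht hst (f := fun x => a⁻¹ * f x) (g := fun x => b⁻¹ * g x)
    (h := fun x => c⁻¹ * h x) (hf.const_mul _) (hg.const_mul _) (hh.const_mul _)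
    (fun x => by
      rw [← ENNReal.inv_mul_cancel a0 aT]; gcongr; exact le_iSup f x)
    (fun x => by
      rw [← ENNReal.inv_mul_cancel b0 bT]; gcongr; exact le_iSup g x)
    (sup f a ha a0 aT) (sup g b hb b0 bT)
    (fun x y => by
      rw [ENNReal.mul_rpow_of_nonneg _ _ hs.le, ENNReal.mul_rpow_of_nonneg _ _ ht.le,
        mul_mul_mul_comm, ci]
      gcongr
      exact H x y)
  have key := (amgm hs ht hst _ _).trans key
  rw [lintegral_const_mul _ hf, lintegral_const_mul _ hg, lintegral_const_mul _ hh,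
    ENNReal.mul_rpow_of_nonneg _ _ hs.le, ENNReal.mul_rpow_of_nonneg _ _ ht.le,
        mul_mul_mul_comm, ci] at key
  rwa [ENNReal.mul_le_mul_iff_right (ENNReal.inv_ne_zero.2 cT) (ENNReal.inv_ne_top.2 c0)] at key

lemma pl_one {s t : ℝ} (hs : 0 < s) (ht : 0 < t) (hst : s + t = 1) {f g h : ℝ → ℝ≥0∞}
    (hf : Measurable f) (hg : Measurable g) (hh : Measurable h)
    (H : ∀ x y, f x ^ s * g y ^ t ≤ h (s * x + t * y)) :
    (∫⁻ x, f x) ^ s * (∫⁻ x, g x) ^ t ≤ ∫⁻ x, h x := by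
  by_cases f0 : ∫⁻ x, f x = 0
  · simp [f0, hs]
  by_cases g0 : ∫⁻ x, g x = 0
  · simp [g0, ht]
  have lim : ∀ f : ℝ → ℝ≥0∞, Measurable f → 
      Tendsto (fun N : ℕ => ∫⁻ x, min (f x) N) atTop (𝓝 (∫⁻ x, f x)) := by
    intro f hf
    apply lintegral_tendsto_of_tendsto_of_monotone
    · intro N; exact (hf.min measurable_const).aemeasurable
    · refine Eventually.of_forall fun x N M h => ?_
      simp only
      gcongr
    · refine Eventually.of_forall fun x => ?_
      have := (tendsto_const_nhds (x := f x)).min ENNReal.tendsto_nat_nhds_top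
      simpa using this
  have l1 := ((ENNReal.continuous_rpow_const (y := s)).tendsto _).comp (lim f hf)
  have l2 := ((ENNReal.continuous_rpow_const (y := t)).tendsto _).comp (lim g hg)
  have l3 := ENNReal.Tendsto.mul l1 (Or.inl (by simp [f0, hs.le])) l2 (Or.inl (by simp [g0, ht.le]))
  refine le_of_tendsto' l3 fun N => ?_
  refine pl_one_bdd hs ht hst (hf.min measurable_const) (hg.min measurable_const) hh N (by simp)
    (fun x => min_le_right _ _) (fun x => min_le_right _ _) fun x y => le_trans ?_ (H x y)
  gcongr <;> exact min_le_left _ _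

lemma pl {s t : ℝ} (hs : 0 < s) (ht : 0 < t) (hst : s + t = 1) (n : ℕ) :
    ∀ {f g h : (Fin n → ℝ) → ℝ≥0∞}
    (_ : Measurable f) (_ : Measurable g) (_ : Measurable h)
    (_ : ∀ x y, f x ^ s * g y ^ t ≤ h (s • x + t • y)),
    (∫⁻ x, f x) ^ s * (∫⁻ x, g x) ^ t ≤ ∫⁻ x, h x := by
  induction n with
  | zero =>
    intro f g h hf hg hh H
    have := H 0 0
    simp only [lintegral_unique]
    simp [volume_pi] 
    convert this using 3 <;> exact congrArg _ (Subsingleton.elim _ _)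
  | succ n ih =>
    intro f g h hf hg hh H
    let e := MeasurableEquiv.piFinSuccAbove (fun _ : Fin (n+1) => ℝ) 0
    have he : MeasurePreserving e.symm := (volume_preserving_piFinSuccAbove (fun _ : Fin (n+1) => ℝ) 0).symm
    have fub : ∀ f : (Fin (n+1) → ℝ) → ℝ≥0∞, Measurable f → 
        ∫⁻ x, f x = ∫⁻ r, ∫⁻ v, f (e.symm (r, v)) := by
      intro f hf
      rw [← he.lintegral_comp hf, Measure.volume_eq_prod,
        lintegral_prod (fun z => f (e.symm z)) (hf.comp e.symm.measurable).aemeasurable]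
    rw [fub f hf, fub g hg, fub h hh]
    refine pl_one hs ht hst ?_ ?_ ?_ ?_
    · exact (hf.comp e.symm.measurable).lintegral_prod_right'
    · exact (hg.comp e.symm.measurable).lintegral_prod_right'
    · exact (hh.comp e.symm.measurable).lintegral_prod_right'
    · intro x y
      refine ih ?_ ?_ ?_ ?_
      · exact (hf.comp e.symm.measurable).comp measurable_prodMk_left
      · exact (hg.comp e.symm.measurable).comp measurable_prodMk_left
      · exact (hh.comp e.symm.measurable).comp measurable_prodMk_left
      · intro v w
        refine (H _ _).trans (le_of_eq ?_)
        congr 1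
        ext i
        refine Fin.cases ?_ (fun j => ?_) i <;> simp [e, Fin.insertNthEquiv]

section
variable {n : ℕ}
local notation "E" => EuclideanSpace ℝ (Fin n)

lemma pl_set {s t : ℝ} (hs : 0 < s) (ht : 0 < t) (hst : s + t = 1) {A B C : Set E}
    (hA : MeasurableSet A) (hB : MeasurableSet B) (hC : MeasurableSet C)
    (H : ∀ x ∈ A, ∀ y ∈ B, s • x + t • y ∈ C) :
    volume A ^ s * volume B ^ t ≤ volume C := by
  have mp := PiLp.volume_preserving_toLp (Fin n)
  have key : ∀ A : Set E, MeasurableSet A →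
      ∫⁻ x : Fin n → ℝ, A.indicator (1 : E → ℝ≥0∞) (WithLp.toLp 2 x) = volume A := by
    intro A hA
    rw [mp.lintegral_comp (measurable_one.indicator hA), lintegral_indicator_one hA]
  have ms : ∀ A : Set E, MeasurableSet A →
      Measurable fun x : Fin n → ℝ => A.indicator (1 : E → ℝ≥0∞) (WithLp.toLp 2 x) := fun A hA =>
    (measurable_one.indicator hA).comp mp.measurable
  rw [← key A hA, ← key B hB, ← key C hC]
  refine pl hs ht hst n (ms A hA) (ms B hB) (ms C hC) fun x y => ?_
  by_cases hx : WithLp.toLp 2 x ∈ A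
  · by_cases hy : WithLp.toLp 2 y ∈ B
    · have := H _ hx _ hy
      simp [hx, hy, this]
    · simp [hy, ht]
  · simp [hx, hs]

lemma vr_smul (c : ℝ) (hc : 0 ≤ c) (A : Set E) :
    (volume (c • A)).toReal = c ^ n * (volume A).toReal := by
  rw [Measure.addHaar_smul]
  simp [abs_of_nonneg hc, pow_nonneg hc n]

lemma vr_smul' (hn : n ≠ 0) (c : ℝ) (hc : 0 ≤ c) (A : Set E) :
    (volume (c • A)).toReal ^ ((1 : ℝ) / n) = c * (volume A).toReal ^ ((1 : ℝ) / n) := by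
  rw [vr_smul c hc, Real.mul_rpow (by positivity) (by positivity), one_div,
    Real.pow_rpow_inv_natCast hc hn]

lemma bm_two (hn : n ≠ 0) {A B : Set E} (hA : IsCompact A) (hB : IsCompact B)
    (nA : A.Nonempty) (nB : B.Nonempty) :
    (volume A).toReal ^ ((1 : ℝ) / n) + (volume B).toReal ^ ((1 : ℝ) / n)
      ≤ (volume (A + B)).toReal ^ ((1 : ℝ) / n) := by
  have hn' : (1 : ℝ) / n ≠ 0 := by positivity
  have fAB := (hA.add hB).measure_ne_top (μ := volume)
  by_cases h0 : (volume A).toReal = 0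
  · rw [h0, Real.zero_rpow hn', zero_add]
    obtain ⟨a, ha⟩ := nA
    refine Real.rpow_le_rpow (by positivity) (ENNReal.toReal_mono fAB ?_) (by positivity)
    have h2 : volume ((fun x => a + x) '' B) = volume B := by simp [measure_preimage_add]
    rw [← h2]
    apply measure_mono
    rintro _ ⟨y, hy, rfl⟩
    exact add_mem_add ha hy
  by_cases h0' : (volume B).toReal = 0
  · rw [h0', Real.zero_rpow hn', add_zero]
    obtain ⟨b, hb⟩ := nB
    refine Real.rpow_le_rpow (by positivity) (ENNReal.toReal_mono fAB ?_) (by positivity)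
    have h1 : volume ((fun x => x + b) '' A) = volume A := by simp [measure_preimage_add_right]
    rw [← h1]
    apply measure_mono
    rintro _ ⟨y, hy, rfl⟩
    exact add_mem_add hy hb
  have pA : 0 < (volume A).toReal := lt_of_le_of_ne ENNReal.toReal_nonneg (Ne.symm h0)
  have pB : 0 < (volume B).toReal := lt_of_le_of_ne ENNReal.toReal_nonneg (Ne.symm h0')
  set a := (volume A).toReal ^ ((1 : ℝ) / n) with ha
  set b := (volume B).toReal ^ ((1 : ℝ) / n) with hb
  have a0 : 0 < a := by positivity
  have b0 : 0 < b := by positivity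
  have an : a ^ n = (volume A).toReal := by
    rw [ha, one_div, Real.rpow_inv_natCast_pow pA.le hn]
  have bn : b ^ n = (volume B).toReal := by
    rw [hb, one_div, Real.rpow_inv_natCast_pow pB.le hn]
  have vol1 : ∀ (A : Set E) (a : ℝ), 0 < a → a ^ n = (volume A).toReal →
      volume (a⁻¹ • A) = 1 := by
    intro A a a0 h
    have := vr_smul a⁻¹ (by positivity) A
    rw [← h, ← mul_pow, inv_mul_cancel₀ a0.ne', one_pow] at this
    rwa [ENNReal.toReal_eq_one_iff] at this
  have key := pl_set (s := a / (a + b)) (t := b / (a + b)) (by positivity) (by positivity)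
    (by field_simp) (A := a⁻¹ • A) (B := b⁻¹ • B) (C := (a + b)⁻¹ • (A + B))
    (hA.smul _).measurableSet (hB.smul _).measurableSet ((hA.add hB).smul _).measurableSet
    (by
      rintro _ ⟨x, hx, rfl⟩ _ ⟨y, hy, rfl⟩
      refine ⟨x + y, add_mem_add hx hy, ?_⟩
      simp only [smul_smul, smul_add]
      congr 2 <;> field_simp)
  rw [vol1 A a a0 an, vol1 B b b0 bn] at key
  simp only [ENNReal.one_rpow, mul_one] at key
  have key2 : 1 ≤ (volume ((a + b)⁻¹ • (A + B))).toReal := by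
    have := ENNReal.toReal_mono (((hA.add hB).smul (a+b)⁻¹).measure_ne_top (μ := volume)) key
    simpa using this
  have key3 : (1:ℝ) ≤ (volume ((a + b)⁻¹ • (A + B))).toReal ^ ((1 : ℝ) / n) :=
    Real.one_le_rpow key2 (by positivity)
  rw [vr_smul' hn _ (by positivity)] at key3
  have := mul_le_mul_of_nonneg_left key3 (show 0 ≤ a + b by positivity)
  rwa [← mul_assoc, mul_inv_cancel₀ (by positivity), one_mul, mul_one] at this

lemma bm_sum (hn : n ≠ 0) {ι : Type*} (S : Finset ι) (A : ι → Set E)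
    (hA : ∀ i, IsCompact (A i)) (nA : ∀ i, (A i).Nonempty) :
    IsCompact (∑ i ∈ S, A i) ∧ (∑ i ∈ S, A i).Nonempty ∧
    ∑ i ∈ S, (volume (A i)).toReal ^ ((1 : ℝ) / n) ≤
      (volume (∑ i ∈ S, A i)).toReal ^ ((1 : ℝ) / n) := by
  classical
  induction S using Finset.induction_on with
  | empty =>
    simp only [Finset.sum_empty]
    refine ⟨isCompact_singleton, ⟨0, rfl⟩, by positivity⟩
  | insert i S hi ih =>
    obtain ⟨h1, h2, h3⟩ := ih
    simp only [Finset.sum_insert hi]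
    refine ⟨(hA i).add h1, (nA i).add h2, ?_⟩
    refine le_trans ?_ (bm_two hn (hA i) h1 (nA i) h2)
    gcongr

lemma bdd_supp {A : Set E} (hA : IsCompact A) (ξ : E) :
    BddAbove ((fun ζ => ⟪ζ, ξ⟫) '' A) :=
  (hA.image (by fun_prop)).bddAbove

lemma le_supp {A : Set E} (hA : IsCompact A) (ξ : E) {x : E} (hx : x ∈ A) :
    ⟪x, ξ⟫ ≤ suppFn A ξ := le_csSup (bdd_supp hA ξ) ⟨x, hx, rfl⟩

lemma supp_lip (A B : ConvexBody E) (ξ : E) :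
    suppFn (A : Set E) ξ ≤ suppFn (B : Set E) ξ + dist A B * ‖ξ‖ := by
  refine csSup_le (A.nonempty.image _) ?_
  rintro _ ⟨x, hx, rfl⟩
  have : ∀ r > dist A B, ⟪x, ξ⟫ ≤ suppFn (B : Set E) ξ + r * ‖ξ‖ := by
    intro r hr
    rw [gt_iff_lt, ← ConvexBody.hausdorffDist_coe] at hr
    obtain ⟨y, hy, hxy⟩ := exists_dist_lt_of_hausdorffDist_lt hx hr ConvexBody.hausdorffEDist_ne_top
    have h1 := le_supp B.isCompact ξ hy
    have h2 : ⟪x - y, ξ⟫ ≤ ‖x - y‖ * ‖ξ‖ := real_inner_le_norm _ _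
    rw [inner_sub_left, ← dist_eq_norm] at h2
    have h3 : dist x y * ‖ξ‖ ≤ r * ‖ξ‖ := by gcongr
    linarith
  have lim : Tendsto (fun r : ℝ => suppFn (B : Set E) ξ + r * ‖ξ‖) (𝓝[>] (dist A B))
      (𝓝 (suppFn (B : Set E) ξ + dist A B * ‖ξ‖)) :=
    tendsto_nhdsWithin_of_tendsto_nhds (Continuous.tendsto (by fun_prop) _)
  exact ge_of_tendsto lim (eventually_nhdsWithin_of_forall this)

lemma supp_cont (ξ : E) : Continuous fun A : ConvexBody E => suppFn (A : Set E) ξ := by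
  refine (LipschitzWith.of_le_add_mul (‖ξ‖₊) fun A B => ?_).continuous
  have := supp_lip A B ξ
  rw [mul_comm] at this
  simpa using this

lemma mem_of_supp (K : ConvexBody E) {δ : ℝ} (hδ : 0 ≤ δ) {x : E}
    (h : ∀ ξ, ⟪x, ξ⟫ ≤ suppFn (K : Set E) ξ + δ * ‖ξ‖) : x ∈ cthickening δ (K : Set E) := by
  obtain ⟨p, hp, hpx⟩ := exists_norm_eq_iInf_of_complete_convex K.nonempty
    K.isCompact.isComplete K.convex x
  rw [norm_eq_iInf_iff_real_inner_le_zero K.convex hp] at hpx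
  have h1 : suppFn (K : Set E) (x - p) ≤ ⟪p, x - p⟫ := by
    refine csSup_le (K.nonempty.image _) ?_
    rintro _ ⟨w, hw, rfl⟩
    have := hpx w hw
    rw [real_inner_comm, inner_sub_left] at this
    simp only
    linarith
  have h2 := h (x - p)
  have h3 : ⟪x - p, x - p⟫ ≤ δ * ‖x - p‖ := by
    rw [inner_sub_left]; linarith
  rw [real_inner_self_eq_norm_mul_norm] at h3
  have h4 : ‖x - p‖ ≤ δ := by
    by_contra hc
    push Not at hc
    nlinarith
  refine mem_cthickening_of_dist_le x p δ _ hp ?_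
  rwa [dist_eq_norm]

lemma exists_simple {D : Type*} [MetricSpace D] [CompactSpace D] [MeasurableSpace D]
    [BorelSpace D] [Nonempty D] {δ : ℝ} (hδ : 0 < δ) :
    ∃ φ : SimpleFunc D D, ∀ y, dist (φ y) y < δ := by
  obtain ⟨t, ht⟩ := (isCompact_univ (X := D)).elim_finite_subcover
    (fun k : ℕ => ball (TopologicalSpace.denseSeq D k) δ) (fun _ => isOpen_ball) (by
      intro y _
      obtain ⟨k, hk⟩ := (TopologicalSpace.denseRange_denseSeq D).exists_dist_lt y hδ
      exact mem_iUnion.2 ⟨k, hk⟩)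
  refine ⟨SimpleFunc.nearestPt (TopologicalSpace.denseSeq D) (t.sup id), fun y => ?_⟩
  obtain ⟨k, hk⟩ := mem_iUnion.1 (ht (mem_univ y))
  obtain ⟨hkt, hk⟩ := mem_iUnion.1 hk
  have := SimpleFunc.edist_nearestPt_le (TopologicalSpace.denseSeq D) y
    (Finset.le_sup (f := id) hkt)
  simp only [id] at this
  rw [edist_dist, edist_dist, ENNReal.ofReal_le_ofReal_iff dist_nonneg] at this
  rw [mem_ball, dist_comm] at hk
  exact this.trans_lt hk

lemma simple_int {D : Type*} [MeasurableSpace D] (μ : Measure D) [IsProbabilityMeasure μ]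
    (φ : SimpleFunc D D) (F : D → ℝ) :
    Integrable (fun y => F (φ y)) μ ∧ 
    ∫ y, F (φ y) ∂μ = ∑ x ∈ φ.range, μ.real (φ ⁻¹' {x}) * F x := by
  have i1 : Integrable (φ.map F) μ := SimpleFunc.integrable_of_isFiniteMeasure _
  refine ⟨i1, ?_⟩
  have e : ∀ y, F (φ y) = ∑ x ∈ φ.range, (φ ⁻¹' {x}).indicator (fun _ => F x) y := by
    intro y
    rw [Finset.sum_eq_single (φ y)]
    · simp
    · intro x _ hx
      rw [indicator_of_notMem]
      simpa using hx.symm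
    · intro h
      exact absurd (SimpleFunc.mem_range_self φ y) h
  simp_rw [e]
  rw [integral_finsetSum]
  · refine Finset.sum_congr rfl fun x _ => ?_
    rw [integral_indicator_const _ (φ.measurableSet_fiber x), smul_eq_mul]
  · intro x _
    exact (integrable_const _).indicator (φ.measurableSet_fiber x)

lemma step {D : Type*} [MetricSpace D]
    [CompactSpace D] [MeasurableSpace D] [BorelSpace D]
    (μ : Measure D) [IsProbabilityMeasure μ] (hn : n ≠ 0)
    (A : D → ConvexBody E) (hA : Continuous A) (K : ConvexBody E)
    (hK : ∀ ξ, suppFn (K : Set E) ξ = ∫ y, suppFn (A y : Set E) ξ ∂μ)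
    (hi : Integrable (fun y => (volume (A y : Set E)).toReal ^ ((1 : ℝ) / n)) μ)
    {ε : ℝ} (hε : 0 < ε) :
    ∫ y, (volume (A y : Set E)).toReal ^ ((1 : ℝ) / n) ∂μ ≤
      (volume (cthickening (ε + ε) (K : Set E))).toReal ^ ((1 : ℝ) / n) := by
  have : Nonempty D := nonempty_of_isProbabilityMeasure μ
  obtain ⟨δ, hδ, hδ'⟩ := Metric.uniformContinuous_iff.1
    (CompactSpace.uniformContinuous_of_continuous hA) ε hε
  obtain ⟨φ, hφ⟩ := exists_simple (D := D) hδ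
  have hd : ∀ y, hausdorffDist (A (φ y) : Set E) (A y) < ε := fun y => by
    rw [ConvexBody.hausdorffDist_coe]; exact hδ' (hφ y)
  set W : D → Set E := fun x => cthickening ε (A x : Set E) with hW
  have cW : ∀ x, IsCompact (W x) := fun x => (A x).isCompact.cthickening
  have nW : ∀ x, (W x).Nonempty := fun x => (A x).nonempty.mono (self_subset_cthickening _)
  obtain ⟨j1, j2⟩ := simple_int μ φ (fun x => (volume (W x)).toReal ^ ((1 : ℝ) / n))
  have h1 : ∫ y, (volume (A y : Set E)).toReal ^ ((1 : ℝ) / n) ∂μ ≤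
      ∫ y, (volume (W (φ y))).toReal ^ ((1 : ℝ) / n) ∂μ := by
    refine integral_mono hi j1 fun y => ?_
    have := (cW (φ y)).measure_ne_top (μ := volume)
    simp only
    gcongr
    intro x hx
    obtain ⟨z, hz, hzx⟩ := exists_dist_lt_of_hausdorffDist_lt' hx (hd y)
      ConvexBody.hausdorffEDist_ne_top
    rw [dist_comm] at hzx
    exact mem_cthickening_of_dist_le x z ε _ hz hzx.le
  refine h1.trans ?_
  rw [j2]
  have h2 := bm_sum hn φ.range (fun x => μ.real (φ ⁻¹' {x}) • W x) (fun x => (cW x).smul _)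
    (fun x => (nW x).smul_set)
  simp only [vr_smul' hn _ measureReal_nonneg] at h2
  refine h2.2.2.trans ?_
  have := (K.isCompact.cthickening (r := ε + ε)).measure_ne_top (μ := volume)
  gcongr
  intro z hz
  obtain ⟨g, hg, rfl⟩ := (Set.mem_finsetSum _ _ _).1 hz
  choose! w hw hwg using fun x (hx : x ∈ φ.range) => hg hx
  refine mem_of_supp K (by positivity) fun ξ => ?_
  obtain ⟨k1, k2⟩ := simple_int μ φ (fun x => ⟪w x, ξ⟫)
  have si : Integrable (fun y => suppFn (A y : Set E) ξ) μ :=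
    ((supp_cont ξ).comp hA).integrable_of_hasCompactSupport (HasCompactSupport.of_compactSpace _)
  have e1 : ⟪∑ x ∈ φ.range, g x, ξ⟫ = ∫ y, ⟪w (φ y), ξ⟫ ∂μ := by
    rw [k2, sum_inner]
    refine Finset.sum_congr rfl fun x hx => ?_
    rw [← hwg x hx, real_inner_smul_left]
  have e2 : suppFn (K : Set E) ξ + (ε + ε) * ‖ξ‖ =
      ∫ y, (suppFn (A y : Set E) ξ + (ε + ε) * ‖ξ‖) ∂μ := by
    rw [integral_add si (integrable_const _), hK]; simp
  rw [e1, e2]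
  refine integral_mono k1 (si.add (integrable_const _)) fun y => ?_
  have m := hw (φ y) (SimpleFunc.mem_range_self φ y)
  rw [hW] at m
  simp only [(A (φ y)).isCompact.cthickening_eq_biUnion_closedBall hε.le, mem_iUnion] at m
  obtain ⟨p, hp, hpw⟩ := m
  rw [mem_closedBall] at hpw
  obtain ⟨q, hq, hqp⟩ := exists_dist_lt_of_hausdorffDist_lt hp (hd y)
      ConvexBody.hausdorffEDist_ne_top
  have a1 := le_supp (A y).isCompact ξ hq
  have a2 : ⟪w (φ y) - q, ξ⟫ ≤ ‖w (φ y) - q‖ * ‖ξ‖ := real_inner_le_norm _ _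
  rw [inner_sub_left, ← dist_eq_norm] at a2
  have a3 : dist (w (φ y)) q * ‖ξ‖ ≤ (ε + ε) * ‖ξ‖ := by
    gcongr
    exact (dist_triangle _ p _).trans (add_le_add hpw hqp.le)
  simp only
  linarith

end

/-- Brunn–Minkowski inequality for Minkowski integrals:
`|∫ A_y dμ(y)|^{1/n} ≥ ∫ |A_y|^{1/n} dμ(y)` for a probability measure `μ`. -/
theorem brunn_minkowski_for_minkowski_integral {n : ℕ} {D : Type*} [MetricSpace D]
    [CompactSpace D] [MeasurableSpace D] [BorelSpace D]
    (μ : Measure D) [IsProbabilityMeasure μ]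
    (A : D → ConvexBody (EuclideanSpace ℝ (Fin n))) (hA : Continuous A)
    (K : ConvexBody (EuclideanSpace ℝ (Fin n)))
    (hK : ∀ ξ, suppFn (K : Set (EuclideanSpace ℝ (Fin n))) ξ
      = ∫ y, suppFn (A y : Set (EuclideanSpace ℝ (Fin n))) ξ ∂μ) :
    (volume (K : Set (EuclideanSpace ℝ (Fin n)))).toReal ^ ((1 : ℝ) / n)
      ≥ ∫ y, (volume (A y : Set (EuclideanSpace ℝ (Fin n)))).toReal ^ ((1 : ℝ) / n) ∂μ := by
  by_cases hn : n = 0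
  · subst hn
    simp
  by_cases hi : Integrable
    (fun y => (volume (A y : Set (EuclideanSpace ℝ (Fin n)))).toReal ^ ((1 : ℝ) / n)) μ
  swap
  · rw [integral_undef hi]
    positivity
  have l1 := tendsto_measure_cthickening_of_isCompact (μ := volume) K.isCompact
  have l2 := (ENNReal.tendsto_toReal (K.isCompact.measure_ne_top (μ := volume))).comp l1
  have l3 := l2.rpow_const (p := (1 : ℝ) / n) (Or.inr (by positivity))
  have l4 : Tendsto (fun ε : ℝ => ε + ε) (𝓝[>] 0) (𝓝 0) :=
    tendsto_nhdsWithin_of_tendsto_nhds (by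
      simpa using (Continuous.tendsto (f := fun ε : ℝ => ε + ε) (by fun_prop) 0))
  refine ge_of_tendsto (l3.comp l4) (eventually_nhdsWithin_of_forall fun ε hε => ?_)
  exact step μ hn A hA K hK hi hε
end

section
/- Let Ω ⊆ ℝ^m be a domain and x ↦ A_x a continuous family of convex bodies in ℝ^n over Ω that is subharmonic, i.e. whenever the closed ball B̄_ε(x) ⊆ Ω, we have A_x ⊇ ∫_{∂B_ε(x)} A_y dS(y) where dS is the normalized surface measure on the sphere ∂B_ε(x). Then the function x ↦ |A_x|^{1/n} is superharmonic on Ω, i.e. it is lower... (upper semicontinuous and) satisfies the super-mean-value property |A_x|^{1/n} ≥ ∫_{∂B_ε(x)} |A_y|^{1/n} dS(y) for all such balls. -/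
open MeasureTheory Metric Set Filter
open scoped RealInnerProductSpace NNReal ENNReal Pointwise Topology

/-- The normalized surface measure on the sphere `∂B_ε(x) ⊆ ℝᵐ`, as normalized
`(m-1)`-dimensional Hausdorff measure. -/
noncomputable def sphereMeasure {m : ℕ} (x : EuclideanSpace ℝ (Fin m)) (ε : ℝ) :
    Measure (EuclideanSpace ℝ (Fin m)) :=
  (μH[(m : ℝ) - 1] (Metric.sphere x ε))⁻¹ • (μH[(m : ℝ) - 1]).restrict (Metric.sphere x ε)

theorem bm1_compact {K L : Set ℝ} (hK : IsCompact K) (hL : IsCompact L) (hK0 : K.Nonempty)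
    (hL0 : L.Nonempty) : volume K + volume L ≤ volume (K + L) := by
  obtain ⟨k, hk, hkm⟩ := hK.exists_isGreatest hK0
  obtain ⟨l, hl, hlm⟩ := hL.exists_isLeast hL0
  have h1 : volume ((fun x => x + l) '' K) = volume K := by simp
  have h2 : volume ((fun x => k + x) '' L) = volume L := by simp
  rw [← h1, ← h2, ← measure_union₀]
  · apply measure_mono
    rintro z (⟨x, hx, rfl⟩ | ⟨x, hx, rfl⟩)
    · exact add_mem_add hx hl
    · exact add_mem_add hk hx
  · exact (hL.image (by fun_prop)).measurableSet.nullMeasurableSet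
  · refine measure_mono_null (t := {k + l}) ?_ (by simp)
    rintro z ⟨⟨x, hx, rfl⟩, ⟨y, hy, h⟩⟩
    have := hkm hx
    have := hlm hy
    simp only [mem_singleton_iff] at *
    linarith

theorem bm1 {A B : Set ℝ} (hA : MeasurableSet A) (hB : MeasurableSet B) (hA0 : A.Nonempty)
    (hB0 : B.Nonempty) : volume A + volume B ≤ volume (A + B) := by
  obtain ⟨a, ha⟩ := hA0
  obtain ⟨b, hb⟩ := hB0
  rw [hA.measure_eq_iSup_isCompact, hB.measure_eq_iSup_isCompact]
  simp only [iSup_and']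
  refine ENNReal.biSup_add_biSup_le' ⟨∅, by simp⟩ ⟨∅, by simp⟩ ?_
  rintro K ⟨hKA, hK⟩ L ⟨hLB, hL⟩
  calc volume K + volume L ≤ volume (insert a K) + volume (insert b L) :=
        add_le_add (measure_mono (subset_insert _ _)) (measure_mono (subset_insert _ _))
    _ ≤ volume (insert a K + insert b L) :=
        bm1_compact (hK.insert a) (hL.insert b) (insert_nonempty _ _) (insert_nonempty _ _)
    _ ≤ _ := measure_mono (add_subset_add (insert_subset ha hKA) (insert_subset hb hLB))

theorem bm1_smul {A B : Set ℝ} (hA : MeasurableSet A) (hB : MeasurableSet B) (hA0 : A.Nonempty)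
    (hB0 : B.Nonempty) {a b : ℝ} (ha : 0 < a) (hb : 0 < b) :
    ENNReal.ofReal a * volume A + ENNReal.ofReal b * volume B ≤ volume (a • A + b • B) := by
  have := bm1 (hA.const_smul₀ a) (hB.const_smul₀ b) hA0.smul_set hB0.smul_set
  simpa [Measure.addHaar_smul, abs_of_pos ha, abs_of_pos hb] using this

theorem pl1_core {f g h : ℝ → ℝ} (hf : Measurable f) (hg : Measurable g) (hh : Measurable h)
    (hf0 : ∀ x, 0 ≤ f x) (hg0 : ∀ x, 0 ≤ g x) (hh0 : ∀ x, 0 ≤ h x)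
    (hf1 : ∀ x, f x ≤ 1) (hg1 : ∀ x, g x ≤ 1)
    (hfs : ∀ t, 0 < t → t < 1 → ∃ x, t < f x) (hgs : ∀ t, 0 < t → t < 1 → ∃ x, t < g x)
    {a b : ℝ} (ha : 0 < a) (hb : 0 < b)
    (H : ∀ t, 0 < t → ∀ x y, t < f x → t < g y → t < h (a * x + b * y)) :
    ENNReal.ofReal a * (∫⁻ x, ENNReal.ofReal (f x)) +
        ENNReal.ofReal b * (∫⁻ x, ENNReal.ofReal (g x))
      ≤ ∫⁻ x, ENNReal.ofReal (h x) := by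
  rw [lintegral_eq_lintegral_meas_lt volume (.of_forall hf0) hf.aemeasurable,
    lintegral_eq_lintegral_meas_lt volume (.of_forall hg0) hg.aemeasurable,
    lintegral_eq_lintegral_meas_lt volume (.of_forall hh0) hh.aemeasurable]
  have m1 : ∀ u : ℝ → ℝ, Measurable fun t : ℝ => volume {x | t < u x} := by
    intro u
    refine Antitone.measurable ?_
    intro s t hst
    exact measure_mono fun x (hx : t < u x) => lt_of_le_of_lt hst hx
  rw [← lintegral_const_mul _ (m1 f), ← lintegral_const_mul _ (m1 g),
    ← lintegral_add_left ((m1 f).const_mul _)]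
  refine setLIntegral_mono (m1 h) ?_
  intro t ht
  by_cases h1 : t < 1
  · refine (bm1_smul (measurableSet_lt measurable_const hf) (measurableSet_lt measurable_const hg)
      (hfs t ht h1) (hgs t ht h1) ha hb).trans (measure_mono ?_)
    rintro _ ⟨_, ⟨x, hx, rfl⟩, _, ⟨y, hy, rfl⟩, rfl⟩
    exact H t ht x y hx hy
  · have e1 : {x | t < f x} = ∅ := by
      ext x; simpa using (hf1 x).trans (not_lt.1 h1)
    have e2 : {x | t < g x} = ∅ := by
      ext x; simpa using (hg1 x).trans (not_lt.1 h1)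
    simp [e1, e2]

theorem amgm_s9 {a b : ℝ} (ha : 0 < a) (hb : 0 < b) (hab : a + b = 1) (F G : ℝ≥0∞) :
    F ^ a * G ^ b ≤ ENNReal.ofReal a * F + ENNReal.ofReal b * G := by
  have hpq : (a⁻¹).HolderConjugate b⁻¹ := by
    refine ⟨by simpa using hab, by positivity, by positivity⟩
  have := ENNReal.young_inequality (F ^ a) (G ^ b) hpq
  rw [← ENNReal.rpow_mul, ← ENNReal.rpow_mul, mul_inv_cancel₀ ha.ne', mul_inv_cancel₀ hb.ne',
    ENNReal.ofReal_inv_of_pos ha, ENNReal.ofReal_inv_of_pos hb] at this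
  simpa [div_eq_mul_inv, mul_comm] using this

/-- The Prékopa–Leindler property. -/
def PL (E : Type*) [AddCommGroup E] [Module ℝ E] [MeasurableSpace E] (μ : Measure E) : Prop :=
  ∀ a b : ℝ, 0 < a → 0 < b → a + b = 1 → ∀ f g h : E → ℝ≥0∞,
    Measurable f → Measurable g → Measurable h →
    (∀ x y, f x ^ a * g y ^ b ≤ h (a • x + b • y)) →
    (∫⁻ x, f x ∂μ) ^ a * (∫⁻ x, g x ∂μ) ^ b ≤ ∫⁻ x, h x ∂μ

theorem PL.prod {E F : Type*} [AddCommGroup E] [Module ℝ E] [MeasurableSpace E]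
    [AddCommGroup F] [Module ℝ F] [MeasurableSpace F] {μ : Measure E} {ν : Measure F}
    [SFinite μ] [SFinite ν] (hμ : PL E μ) (hν : PL F ν) : PL (E × F) (μ.prod ν) := by
  intro a b ha hb hab f g h hf hg hh H
  rw [lintegral_prod_symm' _ hf, lintegral_prod_symm' _ hg, lintegral_prod_symm' _ hh]
  refine hν a b ha hb hab _ _ _ hf.lintegral_prod_left' hg.lintegral_prod_left'
    hh.lintegral_prod_left' ?_
  intro s t
  refine hμ a b ha hb hab _ _ _ (by fun_prop) (by fun_prop) (by fun_prop) ?_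
  intro x y
  exact H (x, s) (y, t)

theorem PL.map {E F : Type*} [AddCommGroup E] [Module ℝ E] [MeasurableSpace E]
    [AddCommGroup F] [Module ℝ F] [MeasurableSpace F] {μ : Measure E} {ν : Measure F}
    (hμ : PL E μ) (e : E → F) (he : MeasurePreserving e μ ν)
    (hl : ∀ (a b : ℝ) x y, e (a • x + b • y) = a • e x + b • e y) : PL F ν := by
  intro a b ha hb hab f g h hf hg hh H
  rw [← he.lintegral_comp hf, ← he.lintegral_comp hg, ← he.lintegral_comp hh]
  refine hμ a b ha hb hab _ _ _ (hf.comp he.measurable) (hg.comp he.measurable)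
    (hh.comp he.measurable) ?_
  intro x y
  rw [hl]
  exact H _ _

theorem PL_real_bdd {a b : ℝ} (ha : 0 < a) (hb : 0 < b) (hab : a + b = 1) {f g h : ℝ → ℝ≥0∞}
    (hf : Measurable f) (hg : Measurable g) (hh : Measurable h)
    (hfM : (⨆ x, f x) ≠ ⊤) (hgN : (⨆ x, g x) ≠ ⊤)
    (H : ∀ x y, f x ^ a * g y ^ b ≤ h (a • x + b • y)) :
    (∫⁻ x, f x) ^ a * (∫⁻ x, g x) ^ b ≤ ∫⁻ x, h x := by
  have hfle : ∀ x, f x ≤ ⨆ x, f x := le_iSup f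
  have hgle : ∀ x, g x ≤ ⨆ x, g x := le_iSup g
  have hfs : ∀ t < ⨆ x, f x, ∃ x, t < f x := fun t ht => lt_iSup_iff.1 ht
  have hgs : ∀ t < ⨆ x, g x, ∃ x, t < g x := fun t ht => lt_iSup_iff.1 ht
  generalize (⨆ x, f x) = M at *
  generalize (⨆ x, g x) = N at *
  rcases eq_or_ne M 0 with rfl | hM
  · have : ∀ x, f x = 0 := fun x => le_antisymm (hfle x) bot_le
    simp [this, ha]
  rcases eq_or_ne N 0 with rfl | hN
  · have : ∀ x, g x = 0 := fun x => le_antisymm (hgle x) bot_le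
    simp [this, hb]
  have hf1 : ∀ x, f x / M ≤ 1 := fun x => ENNReal.div_le_of_le_mul (by simpa using hfle x)
  have hg1 : ∀ x, g x / N ≤ 1 := fun x => ENNReal.div_le_of_le_mul (by simpa using hgle x)
  have hft : ∀ x, f x / M ≠ ⊤ := fun x => ((hf1 x).trans_lt ENNReal.one_lt_top).ne
  have hgt : ∀ x, g x / N ≠ ⊤ := fun x => ((hg1 x).trans_lt ENNReal.one_lt_top).ne
  set P : ℝ≥0∞ := M ^ a * N ^ b with hP
  have hMa0 : M ^ a ≠ 0 := by simp [hM, hfM]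
  have hNb0 : N ^ b ≠ 0 := by simp [hN, hgN]
  have hMat : M ^ a ≠ ⊤ := by simp [hM, hfM]
  have hNbt : N ^ b ≠ ⊤ := by simp [hN, hgN]
  have hP0 : P ≠ 0 := mul_ne_zero hMa0 hNb0
  have hPt : P ≠ ⊤ := ENNReal.mul_ne_top hMat hNbt
  have hdiv : ∀ u v : ℝ≥0∞, (u / M) ^ a * (v / N) ^ b = u ^ a * v ^ b / P := by
    intro u v
    rw [ENNReal.div_rpow_of_nonneg _ _ ha.le, ENNReal.div_rpow_of_nonneg _ _ hb.le, hP,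
      div_eq_mul_inv, div_eq_mul_inv, div_eq_mul_inv,
      ENNReal.mul_inv (Or.inl hMa0) (Or.inl hMat)]
    ring
  have hht : ∀ x, min (h x / P) 1 ≠ ⊤ := fun x =>
    ((min_le_right _ _).trans_lt ENNReal.one_lt_top).ne
  have core := pl1_core (f := fun x => (f x / M).toReal) (g := fun x => (g x / N).toReal)
    (h := fun x => (min (h x / P) 1).toReal) (by fun_prop) (by fun_prop) (by fun_prop)
    (fun x => ENNReal.toReal_nonneg) (fun x => ENNReal.toReal_nonneg)
    (fun x => ENNReal.toReal_nonneg)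
    (fun x => ENNReal.toReal_le_of_le_ofReal zero_le_one (by simpa using hf1 x))
    (fun x => ENNReal.toReal_le_of_le_ofReal zero_le_one (by simpa using hg1 x))
    (by
      intro t ht0 ht
      obtain ⟨x, hx⟩ := hfs (ENNReal.ofReal t * M) (by
        conv_rhs => rw [← one_mul M]
        exact ENNReal.mul_lt_mul_left hM hfM (by simpa using ht))
      refine ⟨x, (ENNReal.ofReal_lt_iff_lt_toReal ht0.le (hft x)).1 ?_⟩
      exact (ENNReal.lt_div_iff_mul_lt (Or.inl hM) (Or.inl hfM)).2 hx)
    (by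
      intro t ht0 ht
      obtain ⟨x, hx⟩ := hgs (ENNReal.ofReal t * N) (by
        conv_rhs => rw [← one_mul N]
        exact ENNReal.mul_lt_mul_left hN hgN (by simpa using ht))
      refine ⟨x, (ENNReal.ofReal_lt_iff_lt_toReal ht0.le (hgt x)).1 ?_⟩
      exact (ENNReal.lt_div_iff_mul_lt (Or.inl hN) (Or.inl hgN)).2 hx)
    ha hb
    (by
      intro t ht x y hx hy
      have hx' : ENNReal.ofReal t < f x / M := (ENNReal.ofReal_lt_iff_lt_toReal ht.le (hft x)).2 hx
      have hy' : ENNReal.ofReal t < g y / N := (ENNReal.ofReal_lt_iff_lt_toReal ht.le (hgt y)).2 hy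
      show t < ENNReal.toReal _
      rw [← ENNReal.ofReal_lt_iff_lt_toReal ht.le (hht _), lt_min_iff]
      refine ⟨?_, hx'.trans_le (hf1 x)⟩
      calc ENNReal.ofReal t = ENNReal.ofReal t ^ a * ENNReal.ofReal t ^ b := by
            rw [← ENNReal.rpow_add _ _ (by simpa using ht) (by simp), hab, ENNReal.rpow_one]
        _ < (f x / M) ^ a * (g y / N) ^ b :=
            ENNReal.mul_lt_mul (ENNReal.rpow_lt_rpow hx' ha) (ENNReal.rpow_lt_rpow hy' hb)
        _ = f x ^ a * g y ^ b / P := hdiv _ _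
        _ ≤ h (a * x + b * y) / P := by gcongr; exact H x y)
  simp only [ENNReal.ofReal_toReal (hft _), ENNReal.ofReal_toReal (hgt _),
    ENNReal.ofReal_toReal (hht _)] at core
  have i1 : ∫⁻ x, f x / M = (∫⁻ x, f x) / M := by
    simp only [div_eq_mul_inv]
    rw [lintegral_mul_const _ hf]
  have i2 : ∫⁻ x, g x / N = (∫⁻ x, g x) / N := by
    simp only [div_eq_mul_inv]
    rw [lintegral_mul_const _ hg]
  have i3 : ∫⁻ x, min (h x / P) 1 ≤ (∫⁻ x, h x) / P := by
    refine (lintegral_mono fun x => min_le_left _ _).trans_eq ?_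
    simp only [div_eq_mul_inv]
    rw [lintegral_mul_const _ hh]
  rw [i1, i2] at core
  have := (amgm_s9 ha hb hab _ _).trans (core.trans i3)
  rw [hdiv] at this
  rw [div_eq_mul_inv, div_eq_mul_inv] at this
  exact (ENNReal.mul_le_mul_iff_left (by simpa using hPt) (by simpa using hP0)).1 this

theorem PL_real : PL ℝ volume := by
  intro a b ha hb hab f g h hf hg hh H
  have key : ∀ u : ℝ → ℝ≥0∞, Measurable u → ∀ c : ℝ, 0 < c →
      (∫⁻ x, u x) ^ c = ⨆ k : ℕ, (∫⁻ x, min (u x) k) ^ c := by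
    intro u hu c hc
    have h1 : ∀ x, u x = ⨆ k : ℕ, min (u x) k := by
      intro x
      rw [← inf_iSup_eq, ENNReal.iSup_natCast, inf_top_eq]
    have h2 : ∫⁻ x, u x = ⨆ k : ℕ, ∫⁻ x, min (u x) k := by
      rw [← lintegral_iSup (fun k => by fun_prop)]
      · exact lintegral_congr h1
      · intro i j hij x
        exact min_le_min le_rfl (by exact_mod_cast hij)
    rw [h2]
    exact (ENNReal.orderIsoRpow c hc).map_iSup _
  rw [key f hf a ha, key g hg b hb]
  simp only [ENNReal.iSup_mul, ENNReal.mul_iSup, iSup_le_iff]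
  intro k l
  refine PL_real_bdd ha hb hab (by fun_prop) (by fun_prop) hh ?_ ?_ ?_
  · exact ((iSup_le fun x => min_le_right _ _).trans_lt (ENNReal.natCast_lt_top _)).ne
  · exact ((iSup_le fun x => min_le_right _ _).trans_lt (ENNReal.natCast_lt_top _)).ne
  · intro x y
    refine le_trans ?_ (H x y)
    gcongr <;> exact min_le_left _ _

theorem PL_pi (n : ℕ) : PL (Fin n → ℝ) volume := by
  induction n with
  | zero =>
    intro a b ha hb hab f g h hf hg hh H
    rw [Measure.volume_pi_eq_dirac 0]
    simp only [lintegral_dirac]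
    convert H 0 0
  | succ n ih =>
    refine (PL_real.prod ih).map _
      (volume_preserving_piFinSuccAbove (fun _ : Fin (n+1) => ℝ) 0).symm ?_
    intro a b x y
    ext i
    refine Fin.cases ?_ (fun j => ?_) i <;> simp [MeasurableEquiv.piFinSuccAbove]

theorem PL_euc (n : ℕ) : PL (EuclideanSpace ℝ (Fin n)) volume :=
  (PL_pi n).map _ (PiLp.volume_preserving_toLp (Fin n)) (fun a b x y => by simp)

/-- `|C|^{1/n}`. -/
noncomputable def vr {n : ℕ} (C : Set (EuclideanSpace ℝ (Fin n))) : ℝ :=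
  (volume C).toReal ^ ((1 : ℝ) / n)

theorem vr_nonneg {n : ℕ} (C : Set (EuclideanSpace ℝ (Fin n))) : 0 ≤ vr C := by
  unfold vr; positivity

theorem vr_mono {n : ℕ} {C D : Set (EuclideanSpace ℝ (Fin n))} (h : C ⊆ D) (hD : IsCompact D) :
    vr C ≤ vr D := by
  unfold vr
  exact Real.rpow_le_rpow ENNReal.toReal_nonneg
    (ENNReal.toReal_mono hD.measure_lt_top.ne (measure_mono h)) (by positivity)

theorem vr_smul_s9 {n : ℕ} (hn : n ≠ 0) (C : Set (EuclideanSpace ℝ (Fin n))) {w : ℝ} (hw : 0 ≤ w) :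
    vr (w • C) = w * vr C := by
  unfold vr
  rw [Measure.addHaar_smul, ENNReal.toReal_mul, ENNReal.toReal_ofReal (abs_nonneg _),
    finrank_euclideanSpace_fin, abs_of_nonneg (by positivity),
    Real.mul_rpow (by positivity) ENNReal.toReal_nonneg, one_div,
    Real.pow_rpow_inv_natCast hw hn]

theorem vr_pow {n : ℕ} (hn : n ≠ 0) (C : Set (EuclideanSpace ℝ (Fin n))) :
    vr C ^ n = (volume C).toReal := by
  unfold vr
  rw [one_div, Real.rpow_inv_natCast_pow ENNReal.toReal_nonneg hn]

theorem bm_euc {n : ℕ} (hn : n ≠ 0) {A B : Set (EuclideanSpace ℝ (Fin n))} (hA : IsCompact A)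
    (hB : IsCompact B) (hA0 : A.Nonempty) (hB0 : B.Nonempty) : vr A + vr B ≤ vr (A + B) := by
  have hAB := hA.add hB
  have triv : ∀ {A B : Set (EuclideanSpace ℝ (Fin n))}, IsCompact A → IsCompact B → A.Nonempty →
      vr B ≤ vr (A + B) := by
    intro A B hA hB hA0
    obtain ⟨x, hx⟩ := hA0
    have h1 : vr (x +ᵥ B) = vr B := by unfold vr; rw [measure_vadd]
    rw [← h1]
    refine vr_mono ?_ (hA.add hB)
    rintro _ ⟨y, hy, rfl⟩
    exact add_mem_add hx hy
  rcases (vr_nonneg A).eq_or_lt with h | ha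
  · rw [← h, zero_add]; exact triv hA hB hA0
  rcases (vr_nonneg B).eq_or_lt with h | hb
  · rw [← h, add_zero, add_comm A B]; exact triv hB hA hB0
  set a := vr A with hadef
  set b := vr B with hbdef
  have unit : ∀ {C : Set (EuclideanSpace ℝ (Fin n))}, IsCompact C → 0 < vr C →
      volume ((vr C)⁻¹ • C) = 1 := by
    intro C hC hc
    have h1 : vr ((vr C)⁻¹ • C) = 1 := by
      rw [vr_smul_s9 hn _ (by positivity), inv_mul_cancel₀ hc.ne']
    have h2 := vr_pow hn ((vr C)⁻¹ • C)
    rw [h1, one_pow] at h2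
    rw [← ENNReal.ofReal_toReal (hC.smul _).measure_lt_top.ne, ← h2, ENNReal.ofReal_one]
  have hmA : MeasurableSet (a⁻¹ • A) := (hA.smul _).measurableSet
  have hmB : MeasurableSet (b⁻¹ • B) := (hB.smul _).measurableSet
  have hmAB : MeasurableSet ((a + b)⁻¹ • (A + B)) := (hAB.smul _).measurableSet
  have key := PL_euc n (a / (a + b)) (b / (a + b)) (by positivity) (by positivity)
    (by field_simp) ((a⁻¹ • A).indicator 1) ((b⁻¹ • B).indicator 1)
    (((a + b)⁻¹ • (A + B)).indicator 1) (measurable_one.indicator hmA)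
    (measurable_one.indicator hmB) (measurable_one.indicator hmAB) (by
      intro x y
      by_cases hx : x ∈ a⁻¹ • A
      · by_cases hy : y ∈ b⁻¹ • B
        · have : (a / (a + b)) • x + (b / (a + b)) • y ∈ (a + b)⁻¹ • (A + B) := by
            obtain ⟨x, hx, rfl⟩ := hx
            obtain ⟨y, hy, rfl⟩ := hy
            refine ⟨x + y, add_mem_add hx hy, ?_⟩
            simp only [smul_smul, smul_add]
            congr 2 <;> field_simp
          rw [indicator_of_mem hx, indicator_of_mem hy, indicator_of_mem this]
          simp
        · have : 0 < b / (a + b) := by positivity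
          simp [hy, this]
      · have : 0 < a / (a + b) := by positivity
        simp [hx, this])
  rw [lintegral_indicator_one hmA, lintegral_indicator_one hmB, lintegral_indicator_one hmAB,
    unit hA ha, unit hB hb, ENNReal.one_rpow, ENNReal.one_rpow, one_mul] at key
  have k2 : 1 ≤ vr ((a + b)⁻¹ • (A + B)) := by
    unfold vr
    refine Real.one_le_rpow ?_ (by positivity)
    have := ENNReal.toReal_mono (hAB.smul _).measure_lt_top.ne key
    simpa using this
  rw [vr_smul_s9 hn _ (by positivity)] at k2
  rwa [inv_mul_eq_div, le_div_iff₀ (by positivity), one_mul] at k2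

theorem bm_sum_s9 {n : ℕ} (hn : n ≠ 0) {ι : Type*} (s : Finset ι) (w : ι → ℝ) (hw : ∀ i, 0 ≤ w i)
    (C : ι → Set (EuclideanSpace ℝ (Fin n))) (hC : ∀ i ∈ s, IsCompact (C i))
    (hC0 : ∀ i ∈ s, (C i).Nonempty) :
    ∑ i ∈ s, w i * vr (C i) ≤ vr (∑ i ∈ s, w i • C i) ∧ IsCompact (∑ i ∈ s, w i • C i) ∧
      (∑ i ∈ s, w i • C i).Nonempty := by
  classical
  induction s using Finset.induction_on with
  | empty => simpa using vr_nonneg _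
  | insert i s his ih =>
    obtain ⟨h1, h2, h3⟩ := ih (fun j hj => hC j (Finset.mem_insert_of_mem hj))
      (fun j hj => hC0 j (Finset.mem_insert_of_mem hj))
    have c1 := (hC i (Finset.mem_insert_self _ _)).smul (w i)
    have c2 := (hC0 i (Finset.mem_insert_self _ _)).smul_set (a := w i)
    simp only [Finset.sum_insert his]
    refine ⟨?_, c1.add h2, c2.add h3⟩
    rw [← vr_smul_s9 hn _ (hw i)]
    exact (add_le_add le_rfl h1).trans (bm_euc hn c1 h2 c2 h3)

section
variable {n : ℕ}

theorem le_suppFn (K : ConvexBody (EuclideanSpace ℝ (Fin n))) {z : EuclideanSpace ℝ (Fin n)}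
    (hz : z ∈ (K : Set (EuclideanSpace ℝ (Fin n)))) (ξ : EuclideanSpace ℝ (Fin n)) :
    ⟪z, ξ⟫ ≤ suppFn (K : Set (EuclideanSpace ℝ (Fin n))) ξ :=
  le_csSup (K.isCompact.image (by fun_prop)).bddAbove ⟨z, hz, rfl⟩

theorem suppFn_le (K : ConvexBody (EuclideanSpace ℝ (Fin n))) {ξ : EuclideanSpace ℝ (Fin n)}
    {c : ℝ} (h : ∀ z ∈ (K : Set (EuclideanSpace ℝ (Fin n))), ⟪z, ξ⟫ ≤ c) :
    suppFn (K : Set (EuclideanSpace ℝ (Fin n))) ξ ≤ c := by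
  refine csSup_le (K.nonempty.image _) ?_
  rintro _ ⟨z, hz, rfl⟩
  exact h z hz

theorem exists_near (K L : ConvexBody (EuclideanSpace ℝ (Fin n))) {z : EuclideanSpace ℝ (Fin n)}
    (hz : z ∈ (K : Set (EuclideanSpace ℝ (Fin n)))) :
    ∃ w ∈ (L : Set (EuclideanSpace ℝ (Fin n))), dist z w ≤ dist K L := by
  obtain ⟨w, hw, h⟩ := L.isCompact.exists_infDist_eq_dist L.nonempty z
  refine ⟨w, hw, ?_⟩
  rw [← h, ← ConvexBody.hausdorffDist_coe]
  exact infDist_le_hausdorffDist_of_mem hz ConvexBody.hausdorffEDist_ne_top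

theorem suppFn_lip (K L : ConvexBody (EuclideanSpace ℝ (Fin n))) (ξ : EuclideanSpace ℝ (Fin n)) :
    suppFn (K : Set (EuclideanSpace ℝ (Fin n))) ξ ≤
      suppFn (L : Set (EuclideanSpace ℝ (Fin n))) ξ + dist K L * ‖ξ‖ := by
  refine suppFn_le K fun z hz => ?_
  obtain ⟨w, hw, h⟩ := exists_near K L hz
  have h1 : ⟪z, ξ⟫ = ⟪w, ξ⟫ + ⟪z - w, ξ⟫ := by rw [← inner_add_left]; simp
  have h2 : ⟪z - w, ξ⟫ ≤ ‖z - w‖ * ‖ξ‖ := real_inner_le_norm _ _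
  rw [dist_eq_norm] at h
  have h3 := mul_le_mul_of_nonneg_right h (norm_nonneg ξ)
  have := le_suppFn L hw ξ
  linarith

theorem suppFn_add (K : ConvexBody (EuclideanSpace ℝ (Fin n))) (ξ η : EuclideanSpace ℝ (Fin n)) :
    suppFn (K : Set (EuclideanSpace ℝ (Fin n))) (ξ + η) ≤
      suppFn (K : Set (EuclideanSpace ℝ (Fin n))) ξ +
      suppFn (K : Set (EuclideanSpace ℝ (Fin n))) η := by
  refine suppFn_le K fun z hz => ?_
  rw [inner_add_right]
  exact add_le_add (le_suppFn K hz _) (le_suppFn K hz _)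

theorem suppFn_smul (K : Set (EuclideanSpace ℝ (Fin n))) {c : ℝ} (hc : 0 < c)
    (ξ : EuclideanSpace ℝ (Fin n)) : suppFn K (c • ξ) = c * suppFn K ξ := by
  unfold suppFn
  rw [← smul_eq_mul, ← Real.sSup_smul_of_nonneg hc.le]
  congr 1
  ext r
  simp [mem_smul_set, inner_smul_right]

theorem exists_body (H : EuclideanSpace ℝ (Fin n) → ℝ)
    (hom : ∀ c : ℝ, 0 < c → ∀ ξ, H (c • ξ) = c * H ξ) (hadd : ∀ ξ η, H (ξ + η) ≤ H ξ + H η)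
    (C : ℝ) (hC : ∀ ξ, H ξ ≤ C * ‖ξ‖) :
    ∃ K : ConvexBody (EuclideanSpace ℝ (Fin n)),
      ∀ ξ, suppFn (K : Set (EuclideanSpace ℝ (Fin n))) ξ = H ξ := by
  have H0 : H 0 = 0 := by
    have := hom 2 (by norm_num) 0
    rw [smul_zero] at this
    linarith
  have ex : ∀ ξ₀, ∃ z : EuclideanSpace ℝ (Fin n), (∀ ξ, ⟪z, ξ⟫ ≤ H ξ) ∧ ⟪z, ξ₀⟫ = H ξ₀ := by
    intro ξ₀
    obtain ⟨g, hg1, hg2⟩ : ∃ g : EuclideanSpace ℝ (Fin n) →ₗ[ℝ] ℝ, g ξ₀ = H ξ₀ ∧ ∀ x, g x ≤ H x := by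
      rcases eq_or_ne ξ₀ 0 with rfl | h0
      · obtain ⟨g, -, hg⟩ := exists_extension_of_le_sublinear
          (⊥ : EuclideanSpace ℝ (Fin n) →ₗ.[ℝ] ℝ) H hom hadd (by
            rintro ⟨x, hx⟩
            have : x = 0 := (Submodule.mem_bot ℝ).1 hx
            subst this
            exact (LinearPMap.map_zero _).le.trans H0.ge)
        exact ⟨g, by rw [map_zero, H0], hg⟩
      · obtain ⟨g, hg1, hg⟩ := exists_extension_of_le_sublinear
          (LinearPMap.mkSpanSingleton (K := ℝ) ξ₀ (H ξ₀) h0) H hom hadd (by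
            rintro ⟨x, hx⟩
            obtain ⟨c, rfl⟩ := Submodule.mem_span_singleton.1 hx
            have e : (LinearPMap.mkSpanSingleton (K := ℝ) ξ₀ (H ξ₀) h0) ⟨c • ξ₀, hx⟩ = c * H ξ₀ := by
              simpa using LinearPMap.mkSpanSingleton'_apply (R := ℝ) ξ₀ (H ξ₀) _ c hx
            refine e.le.trans ?_
            show c * H ξ₀ ≤ H (c • ξ₀)
            rcases lt_trichotomy c 0 with hc | rfl | hc
            · have h1 := hadd (c • ξ₀) ((-c) • ξ₀)
              rw [← add_smul, add_neg_cancel, zero_smul, H0, hom (-c) (by linarith)] at h1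
              linarith
            · simp [H0]
            · exact (hom c hc ξ₀).ge)
        refine ⟨g, ?_, hg⟩
        have := hg1 ⟨ξ₀, Submodule.mem_span_singleton_self _⟩
        rw [LinearPMap.mkSpanSingleton_apply] at this
        exact this
    refine ⟨(InnerProductSpace.toDual ℝ _).symm (LinearMap.toContinuousLinearMap g), ?_, ?_⟩
    · intro ξ
      rw [InnerProductSpace.toDual_symm_apply]
      exact hg2 ξ
    · rw [InnerProductSpace.toDual_symm_apply]
      exact hg1
  have hbd : ∀ z : EuclideanSpace ℝ (Fin n), (∀ ξ, ⟪z, ξ⟫ ≤ H ξ) → ‖z‖ ≤ C ∨ z = 0 := by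
    intro z hz
    by_cases h0 : z = 0
    · exact Or.inr h0
    left
    have h1 := (hz z).trans (hC z)
    rw [real_inner_self_eq_norm_mul_norm] at h1
    exact le_of_mul_le_mul_right h1 (norm_pos_iff.2 h0)
  have hcl : IsClosed {z : EuclideanSpace ℝ (Fin n) | ∀ ξ, ⟪z, ξ⟫ ≤ H ξ} := by
    simp only [ofPred_forall]
    exact isClosed_iInter fun ξ => isClosed_le (by fun_prop) continuous_const
  let K : ConvexBody (EuclideanSpace ℝ (Fin n)) :=
    { carrier := {z | ∀ ξ, ⟪z, ξ⟫ ≤ H ξ}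
      convex' := by
        intro x hx y hy a b ha hb hab ξ
        rw [inner_add_left, real_inner_smul_left, real_inner_smul_left]
        calc a * ⟪x, ξ⟫ + b * ⟪y, ξ⟫ ≤ a * H ξ + b * H ξ :=
              add_le_add (mul_le_mul_of_nonneg_left (hx ξ) ha)
                (mul_le_mul_of_nonneg_left (hy ξ) hb)
          _ = H ξ := by rw [← add_mul, hab, one_mul]
      isCompact' := by
        refine Metric.isCompact_of_isClosed_isBounded hcl ?_
        refine (Metric.isBounded_closedBall (x := 0) (r := max C 0)).subset ?_
        intro z hz
        rw [mem_closedBall_zero_iff]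
        rcases hbd z hz with h | h
        · exact h.trans (le_max_left _ _)
        · rw [h, norm_zero]; exact le_max_right _ _
      nonempty' := by
        obtain ⟨z, hz, -⟩ := ex 0
        exact ⟨z, hz⟩ }
  refine ⟨K, fun ξ => le_antisymm (suppFn_le K fun z hz => hz ξ) ?_⟩
  obtain ⟨z, hz, h⟩ := ex ξ
  rw [← h]
  exact le_suppFn K (show z ∈ (K : Set _) from hz) ξ

theorem mem_cthickening_of_supp (K : ConvexBody (EuclideanSpace ℝ (Fin n))) {r : ℝ} (hr : 0 ≤ r)
    {z : EuclideanSpace ℝ (Fin n)}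
    (h : ∀ ξ, ⟪z, ξ⟫ ≤ suppFn (K : Set (EuclideanSpace ℝ (Fin n))) ξ + r * ‖ξ‖) :
    z ∈ cthickening r (K : Set (EuclideanSpace ℝ (Fin n))) := by
  by_contra hz
  obtain ⟨f, u, h1, h2⟩ := geometric_hahn_banach_closed_point (K.convex.cthickening r)
    isClosed_cthickening hz
  obtain ⟨ξ, rfl⟩ := (InnerProductSpace.toDual ℝ (EuclideanSpace ℝ (Fin n))).surjective f
  simp only [InnerProductSpace.toDual_apply_apply] at h1 h2
  have h3 : suppFn (K : Set (EuclideanSpace ℝ (Fin n))) ξ ≤ u - r * ‖ξ‖ := by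
    refine suppFn_le K fun k hk => ?_
    have := h1 (k + (r * ‖ξ‖⁻¹) • ξ) (mem_cthickening_of_dist_le _ k _ _ hk (by
      rw [dist_eq_norm, add_sub_cancel_left, norm_smul, norm_mul, norm_inv, norm_norm,
        Real.norm_of_nonneg hr, mul_assoc]
      exact mul_le_of_le_one_right hr (inv_mul_le_one)))
    rw [inner_add_right, real_inner_smul_right, real_inner_self_eq_norm_mul_norm,
      real_inner_comm] at this
    have e : r * ‖ξ‖⁻¹ * (‖ξ‖ * ‖ξ‖) = r * ‖ξ‖ := by
      by_cases h0 : ‖ξ‖ = 0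
      · simp [h0]
      · field_simp
    linarith
  have := h ξ
  rw [real_inner_comm] at this
  linarith
end

theorem exists_simple_s9 {m : ℕ} {S : Set (EuclideanSpace ℝ (Fin m))} (hS : IsCompact S)
    (hS0 : S.Nonempty) {η : ℝ} (hη : 0 < η) :
    ∃ φ : SimpleFunc (EuclideanSpace ℝ (Fin m)) (EuclideanSpace ℝ (Fin m)),
      (∀ y, φ y ∈ S) ∧ ∀ y ∈ S, dist (φ y) y < η := by
  obtain ⟨t, htS, htf, hcov⟩ := hS.finite_cover_balls hη
  have ht0 : t.Nonempty := by
    obtain ⟨y, hy⟩ := hS0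
    obtain ⟨x, hx, -⟩ := mem_iUnion₂.1 (hcov hy)
    exact ⟨x, hx⟩
  obtain ⟨e, rfl⟩ := htf.countable.exists_eq_range ht0
  have : ∀ x : EuclideanSpace ℝ (Fin m), ∃ k, x ∈ range e → e k = x := by
    intro x
    by_cases hx : x ∈ range e
    · obtain ⟨k, hk⟩ := hx
      exact ⟨k, fun _ => hk⟩
    · exact ⟨0, fun h => absurd h hx⟩
  choose k hk using this
  obtain ⟨N, hN⟩ := (htf.image k).bddAbove
  refine ⟨SimpleFunc.nearestPt e N, ?_, ?_⟩
  · intro y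
    exact htS ⟨_, rfl⟩
  · intro y hy
    obtain ⟨x, hx, hxy⟩ := mem_iUnion₂.1 (hcov hy)
    have h1 := SimpleFunc.edist_nearestPt_le e y (hN ⟨x, hx, rfl⟩)
    rw [hk x hx] at h1
    rw [edist_dist, edist_dist, ENNReal.ofReal_le_ofReal_iff dist_nonneg] at h1
    rw [mem_ball, dist_comm] at hxy
    exact h1.trans_lt hxy

theorem integral_vr_le {n m : ℕ} (hn : n ≠ 0) (μ : Measure (EuclideanSpace ℝ (Fin m)))
    [IsProbabilityMeasure μ] {S : Set (EuclideanSpace ℝ (Fin m))} (hS : IsCompact S)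
    (hS0 : S.Nonempty) (hμS : ∀ᵐ y ∂μ, y ∈ S)
    (A : EuclideanSpace ℝ (Fin m) → ConvexBody (EuclideanSpace ℝ (Fin n)))
    (hA : ContinuousOn A S)
    (hsuppInt : ∀ ξ, Integrable (fun y => suppFn (A y : Set (EuclideanSpace ℝ (Fin n))) ξ) μ)
    (K : ConvexBody (EuclideanSpace ℝ (Fin n)))
    (hK : ∀ ξ, suppFn (K : Set (EuclideanSpace ℝ (Fin n))) ξ
          = ∫ y, suppFn (A y : Set (EuclideanSpace ℝ (Fin n))) ξ ∂μ) :
    ∫ y, vr (A y : Set (EuclideanSpace ℝ (Fin n))) ∂μ ≤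
      vr (K : Set (EuclideanSpace ℝ (Fin n))) := by
  have step : ∀ δ : ℝ, 0 < δ → ∫ y, vr (A y : Set (EuclideanSpace ℝ (Fin n))) ∂μ ≤
      vr (cthickening (2 * δ) (K : Set (EuclideanSpace ℝ (Fin n)))) := by
    intro δ hδ
    by_cases hi : Integrable (fun y => vr (A y : Set (EuclideanSpace ℝ (Fin n)))) μ
    swap
    · rw [integral_undef hi]; exact vr_nonneg _
    obtain ⟨η, hη, hu⟩ := Metric.uniformContinuousOn_iff.1
      (hS.uniformContinuousOn_of_continuous hA) δ hδ
    obtain ⟨φ, hφS, hφ⟩ := exists_simple_s9 hS hS0 hη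
    let C : EuclideanSpace ℝ (Fin m) → Set (EuclideanSpace ℝ (Fin n)) :=
      fun v => cthickening δ (A v : Set (EuclideanSpace ℝ (Fin n)))
    have hC : ∀ v, IsCompact (C v) := fun v => (A v).isCompact.cthickening
    have hC0 : ∀ v, (C v).Nonempty := fun v => (A v).nonempty.mono (self_subset_cthickening _)
    have hsum : ∀ F : EuclideanSpace ℝ (Fin m) → ℝ, Integrable (fun y => F (φ y)) μ ∧
        ∫ y, F (φ y) ∂μ = ∑ v ∈ φ.range, μ.real (φ ⁻¹' {v}) * F v := by
      intro F
      have h1 : Integrable (φ.map F) μ := SimpleFunc.integrable_of_isFiniteMeasure _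
      refine ⟨h1, ?_⟩
      have h2 : (fun y => F (φ y)) =
          fun y => ∑ v ∈ φ.range, (φ ⁻¹' {v}).indicator (fun _ => F v) y := by
        funext y
        rw [Finset.sum_eq_single (φ y)]
        · simp
        · intro v _ hv
          exact indicator_of_notMem (fun h => hv (by simpa using h.symm)) _
        · intro h
          exact absurd (SimpleFunc.mem_range_self φ y) h
      rw [h2, integral_finsetSum]
      · refine Finset.sum_congr rfl fun v _ => ?_
        rw [integral_indicator_const _ (φ.measurableSet_preimage {v}), smul_eq_mul]
      · intro v _
        exact (integrable_const _).indicator (φ.measurableSet_preimage {v})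
    have hd : ∀ y ∈ S, dist (A (φ y)) (A y) ≤ δ := fun y hy =>
      (hu _ (hφS y) _ hy (hφ y hy)).le
    obtain ⟨b1, b2, b3⟩ := bm_sum_s9 hn φ.range (fun v => μ.real (φ ⁻¹' {v}))
      (fun v => measureReal_nonneg) C (fun v _ => hC v) (fun v _ => hC0 v)
    calc ∫ y, vr (A y : Set (EuclideanSpace ℝ (Fin n))) ∂μ ≤ ∫ y, vr (C (φ y)) ∂μ := by
          refine integral_mono_ae hi (hsum fun v => vr (C v)).1 ?_
          filter_upwards [hμS] with y hy
          refine vr_mono ?_ (hC _)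
          intro z hz
          obtain ⟨w, hw, h⟩ := exists_near (A y) (A (φ y)) hz
          refine mem_cthickening_of_dist_le _ w _ _ hw (h.trans ?_)
          rw [dist_comm]
          exact hd y hy
      _ = ∑ v ∈ φ.range, μ.real (φ ⁻¹' {v}) * vr (C v) := (hsum fun v => vr (C v)).2
      _ ≤ vr (∑ v ∈ φ.range, μ.real (φ ⁻¹' {v}) • C v) := b1
      _ ≤ _ := by
          refine vr_mono ?_ K.isCompact.cthickening
          intro z hz
          refine mem_cthickening_of_supp K (by positivity) fun ξ => ?_
          obtain ⟨g, hg, rfl⟩ := (Set.mem_finsetSum _ _ _).1 hz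
          have e1 : ⟪∑ v ∈ φ.range, g v, ξ⟫ ≤ ∑ v ∈ φ.range, μ.real (φ ⁻¹' {v}) *
              (suppFn (A v : Set (EuclideanSpace ℝ (Fin n))) ξ + δ * ‖ξ‖) := by
            rw [sum_inner]
            refine Finset.sum_le_sum fun v hv => ?_
            obtain ⟨c, hc, hcv⟩ := hg hv
            simp only at hcv
            rw [← hcv, real_inner_smul_left]
            refine mul_le_mul_of_nonneg_left ?_ measureReal_nonneg
            obtain ⟨w, hw, h⟩ : ∃ w ∈ (A v : Set (EuclideanSpace ℝ (Fin n))), dist c w ≤ δ := by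
              have hc' := hc
              simp only [C] at hc'
              rw [(A v).isCompact.cthickening_eq_biUnion_closedBall hδ.le] at hc'
              simpa using hc'
            have h1 : ⟪c, ξ⟫ = ⟪w, ξ⟫ + ⟪c - w, ξ⟫ := by rw [← inner_add_left]; simp
            have h2 : ⟪c - w, ξ⟫ ≤ ‖c - w‖ * ‖ξ‖ := real_inner_le_norm _ _
            rw [dist_eq_norm] at h
            have h3 := mul_le_mul_of_nonneg_right h (norm_nonneg ξ)
            have := le_suppFn (A v) hw ξ
            linarith
          have hs := hsum fun v => suppFn (A v : Set (EuclideanSpace ℝ (Fin n))) ξ + δ * ‖ξ‖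
          rw [← hs.2] at e1
          refine e1.trans ?_
          calc _ ≤ ∫ y, (suppFn (A y : Set (EuclideanSpace ℝ (Fin n))) ξ + 2 * δ * ‖ξ‖) ∂μ := by
                refine integral_mono_ae hs.1 ((hsuppInt ξ).add (integrable_const _)) ?_
                filter_upwards [hμS] with y hy
                have h1 := suppFn_lip (A (φ y)) (A y) ξ
                have h2 := mul_le_mul_of_nonneg_right (hd y hy) (norm_nonneg ξ)
                linarith
            _ = _ := by
                rw [integral_add (hsuppInt ξ) (integrable_const _), hK ξ]
                simp
  have lim : Tendsto (fun δ : ℝ => vr (cthickening (2 * δ) (K : Set (EuclideanSpace ℝ (Fin n)))))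
      (𝓝[>] 0) (𝓝 (vr (K : Set (EuclideanSpace ℝ (Fin n))))) := by
    have h1 : Tendsto (fun δ : ℝ => 2 * δ) (𝓝[>] 0) (𝓝 0) := by
      refine (Continuous.tendsto' (by fun_prop) _ _ (by simp)).mono_left nhdsWithin_le_nhds
    have h2 := (tendsto_measure_cthickening_of_isCompact (μ := volume) K.isCompact).comp h1
    have h3 := (ENNReal.tendsto_toReal K.isCompact.measure_lt_top.ne).comp h2
    exact h3.rpow_const (Or.inr (by positivity))
  refine ge_of_tendsto lim ?_
  filter_upwards [self_mem_nhdsWithin] with δ hδ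
  exact step δ hδ

theorem sphereMeasure_cases {m : ℕ} (x : EuclideanSpace ℝ (Fin m)) (ε : ℝ) :
    sphereMeasure x ε = 0 ∨ IsProbabilityMeasure (sphereMeasure x ε) := by
  unfold sphereMeasure
  rcases eq_or_ne (μH[(m : ℝ) - 1] (Metric.sphere x ε)) 0 with h0 | h0
  · left
    rw [Measure.restrict_eq_zero.2 h0, smul_zero]
  rcases eq_or_ne (μH[(m : ℝ) - 1] (Metric.sphere x ε)) ⊤ with h1 | h1
  · left
    rw [h1, ENNReal.inv_top, zero_smul]
  right
  refine ⟨?_⟩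
  rw [Measure.smul_apply, Measure.restrict_apply_univ, smul_eq_mul, ENNReal.inv_mul_cancel h0 h1]

theorem ae_mem_sphere {m : ℕ} (x : EuclideanSpace ℝ (Fin m)) (ε : ℝ) :
    ∀ᵐ y ∂(sphereMeasure x ε), y ∈ Metric.sphere x ε := by
  unfold sphereMeasure
  refine Measure.ae_smul_measure ?_ _
  exact ae_restrict_mem Metric.isClosed_sphere.measurableSet

/-- If `x ↦ A_x` is a continuous subharmonic family of convex bodies over a domain
`Ω ⊆ ℝᵐ`, then `x ↦ |A_x|^{1/n}` is superharmonic: it satisfies the super-mean-value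
property over all spheres whose closed ball lies in `Ω`. -/
theorem subharmonic_family_volume_superharmonic {n m : ℕ}
    (Ω : Set (EuclideanSpace ℝ (Fin m))) (hΩ : IsOpen Ω)
    (A : EuclideanSpace ℝ (Fin m) → ConvexBody (EuclideanSpace ℝ (Fin n)))
    (hA : ContinuousOn A Ω)
    (hsub : ∀ x ε, 0 < ε → Metric.closedBall x ε ⊆ Ω →
      ∀ K : ConvexBody (EuclideanSpace ℝ (Fin n)),
        (∀ ξ, suppFn (K : Set (EuclideanSpace ℝ (Fin n))) ξ
          = ∫ y, suppFn (A y : Set (EuclideanSpace ℝ (Fin n))) ξ ∂(sphereMeasure x ε)) →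
        (K : Set (EuclideanSpace ℝ (Fin n))) ⊆ (A x : Set (EuclideanSpace ℝ (Fin n)))) :
    ∀ x ε, 0 < ε → Metric.closedBall x ε ⊆ Ω →
      (volume (A x : Set (EuclideanSpace ℝ (Fin n)))).toReal ^ ((1 : ℝ) / n)
        ≥ ∫ y, (volume (A y : Set (EuclideanSpace ℝ (Fin n)))).toReal ^ ((1 : ℝ) / n)
            ∂(sphereMeasure x ε) := by
  intro x ε hε hball
  rcases sphereMeasure_cases x ε with h0 | hprob
  · rw [h0, integral_zero_measure]
    positivity
  rcases eq_or_ne n 0 with rfl | hn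
  · simp
  have hS : IsCompact (Metric.sphere x ε) := isCompact_sphere x ε
  have hSΩ : Metric.sphere x ε ⊆ Ω := Metric.sphere_subset_closedBall.trans hball
  have hμS := ae_mem_sphere x ε
  have hS0 : (Metric.sphere x ε).Nonempty := hμS.exists
  have hAS : ContinuousOn A (Metric.sphere x ε) := hA.mono hSΩ
  have hcont : ∀ ξ, ContinuousOn
      (fun y => suppFn (A y : Set (EuclideanSpace ℝ (Fin n))) ξ) (Metric.sphere x ε) := by
    intro ξ
    have hl : Continuous fun B : ConvexBody (EuclideanSpace ℝ (Fin n)) =>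
        suppFn (B : Set (EuclideanSpace ℝ (Fin n))) ξ := by
      refine (LipschitzWith.of_le_add_mul ‖ξ‖₊ fun B B' => ?_).continuous
      rw [mul_comm]
      exact suppFn_lip B B' ξ
    exact hl.comp_continuousOn hAS
  have hsuppInt : ∀ ξ, Integrable
      (fun y => suppFn (A y : Set (EuclideanSpace ℝ (Fin n))) ξ) (sphereMeasure x ε) := by
    intro ξ
    have h1 := (hcont ξ).integrableOn_compact (μ := sphereMeasure x ε) hS
    rwa [IntegrableOn, Measure.restrict_eq_self_of_ae_mem hμS] at h1
  obtain ⟨D, hD⟩ := (hS.image_of_continuousOn hAS).isBounded.subset_closedBall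
    (0 : ConvexBody (EuclideanSpace ℝ (Fin n)))
  obtain ⟨K, hK⟩ := exists_body
    (fun ξ => ∫ y, suppFn (A y : Set (EuclideanSpace ℝ (Fin n))) ξ ∂(sphereMeasure x ε))
    (by
      intro c hc ξ
      simp only [suppFn_smul _ hc]
      rw [integral_const_mul])
    (by
      intro ξ η
      rw [← integral_add (hsuppInt ξ) (hsuppInt η)]
      exact integral_mono (hsuppInt _) ((hsuppInt ξ).add (hsuppInt η)) fun y => suppFn_add (A y) ξ η)
    D
    (by
      intro ξ
      have h1 : ∫ y, suppFn (A y : Set (EuclideanSpace ℝ (Fin n))) ξ ∂(sphereMeasure x ε) ≤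
          ∫ y, D * ‖ξ‖ ∂(sphereMeasure x ε) := by
        refine integral_mono_ae (hsuppInt ξ) (integrable_const _) ?_
        filter_upwards [hμS] with y hy
        have h2 := suppFn_lip (A y) 0 ξ
        have h3 : suppFn ((0 : ConvexBody (EuclideanSpace ℝ (Fin n))) :
            Set (EuclideanSpace ℝ (Fin n))) ξ = 0 := by
          simp [suppFn]
        have h4 : dist (A y) 0 ≤ D := hD ⟨y, hy, rfl⟩
        have h5 := mul_le_mul_of_nonneg_right h4 (norm_nonneg ξ)
        linarith
      simpa using h1)
  have hsubK := hsub x ε hε hball K hK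
  exact (integral_vr_le hn (sphereMeasure x ε) hS hS0 hμS A hAS hsuppInt K hK).trans
    (vr_mono hsubK (A x).isCompact)
end

section
/- Let Y be a random vector in ℝ^n with E|Y| < ∞, with law ν. Define the Vitale zonoid Z(Y) = ∫_{ℝ^n} [0,y] dν(y) (Minkowski integral of segments). If M_Y is the n×n random matrix whose columns are n independent copies of Y, then E|det M_Y| = n! · |Z(Y)|, where |·| is Lebesgue volume. -/
open MeasureTheory Metric Set Filter
open scoped RealInnerProductSpace NNReal ENNReal Pointwise Topology

/-- The zonotope spanned by a finite family of vectors. -/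
def zono {ι E : Type*} [AddCommGroup E] [Module ℝ E] (v : ι → E) (s : Finset ι) : Set E :=
  ∑ i ∈ s, segment ℝ 0 (v i)

lemma zono_empty {ι E : Type*} [AddCommGroup E] [Module ℝ E] (v : ι → E) :
    zono v ∅ = {0} := by
  simp only [zono, Finset.sum_empty]
  exact Set.singleton_zero.symm

lemma zono_insert {ι E : Type*} [DecidableEq ι] [AddCommGroup E] [Module ℝ E] (v : ι → E)
    {a : ι} {s : Finset ι} (h : a ∉ s) :
    zono v (insert a s) = segment ℝ 0 (v a) + zono v s := by
  simp [zono, Finset.sum_insert h]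

lemma zono_image {ι E F : Type*} [AddCommGroup E] [Module ℝ E] [AddCommGroup F] [Module ℝ F]
    (A : E →ₗ[ℝ] F) (v : ι → E) (s : Finset ι) :
    A '' zono v s = zono (fun i => A (v i)) s := by
  unfold zono
  rw [Set.image_finsetSum]
  refine Finset.sum_congr rfl fun i _ => ?_
  have := image_segment ℝ A.toAffineMap 0 (v i)
  simpa using this

lemma isCompact_zero_segment {E : Type*} [NormedAddCommGroup E] [NormedSpace ℝ E] (y : E) :
    IsCompact (segment ℝ 0 y) := by
  rw [segment_eq_image']
  exact isCompact_Icc.image (by fun_prop)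

lemma zono_convex {ι E : Type*} [AddCommGroup E] [Module ℝ E] (v : ι → E) (s : Finset ι) :
    Convex ℝ (zono v s) :=
  convex_sum _ fun _ _ => convex_segment _ _

lemma zono_isCompact {ι E : Type*} [NormedAddCommGroup E] [NormedSpace ℝ E] (v : ι → E)
    (s : Finset ι) : IsCompact (zono v s) := by
  classical
  induction s using Finset.induction_on with
  | empty => rw [zono_empty]; exact isCompact_singleton
  | insert a s h ih => rw [zono_insert v h]; exact (isCompact_zero_segment _).add ih

lemma zono_nonempty {ι E : Type*} [AddCommGroup E] [Module ℝ E] (v : ι → E)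
    (s : Finset ι) : (zono v s).Nonempty := by
  classical
  induction s using Finset.induction_on with
  | empty => rw [zono_empty]; exact Set.singleton_nonempty _
  | insert a s h ih => rw [zono_insert v h]; exact Set.Nonempty.add ⟨0, left_mem_segment _ _ _⟩ ih

lemma volume_compact_convex_add_Icc {S : Set ℝ} (hS : IsCompact S) (hc : Convex ℝ S)
    (hne : S.Nonempty) : volume (Set.Icc (0:ℝ) 1 + S) = volume S + 1 := by
  obtain ⟨a, b, hab, rfl⟩ : ∃ a b : ℝ, a ≤ b ∧ S = Set.Icc a b := by
    refine ⟨sInf S, sSup S, ?_, ?_⟩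
    · exact Real.sInf_le_sSup S hS.bddBelow hS.bddAbove
    · exact eq_Icc_of_connected_compact ⟨hne, hc.isPreconnected⟩ hS
  rw [Set.Icc_add_Icc zero_le_one hab, Real.volume_Icc, Real.volume_Icc, ← ENNReal.ofReal_one,
    ← ENNReal.ofReal_add (by linarith) zero_le_one]
  congr 1; ring

/-- Fubini: adding the unit segment in a coordinate direction. -/
lemma volume_add_segment {n : ℕ} {K : Set (Fin (n+1) → ℝ)} (hK : IsCompact K)
    (hc : Convex ℝ K) :
    volume (segment ℝ 0 (Pi.single 0 1) + K) = volume K + volume ((fun x => Fin.tail x) '' K) := by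
  set e := (MeasurableEquiv.piFinSuccAbove (fun _ : Fin (n+1) => ℝ) 0) with he
  have hmp := volume_preserving_piFinSuccAbove (fun _ : Fin (n+1) => ℝ) 0
  have hcomp : ∀ L : Set (Fin (n+1) → ℝ), IsCompact L →
      volume L = ∫⁻ y : Fin n → ℝ, volume {t : ℝ | (Fin.cons t y : Fin (n+1) → ℝ) ∈ L} := by
    intro L hL
    have h1 := hmp.symm.measure_preimage hL.measurableSet.nullMeasurableSet
    rw [← h1, Measure.volume_eq_prod, Measure.prod_apply_symm]
    · refine lintegral_congr fun y => congrArg _ ?_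
      ext t
      have : (MeasurableEquiv.piFinSuccAbove (fun _ : Fin (n+1) => ℝ) 0).symm (t, y)
          = (Fin.cons t y : Fin (n+1) → ℝ) := by
        ext j
        refine Fin.cases ?_ (fun j => ?_) j <;> simp [MeasurableEquiv.piFinSuccAbove]
      simp only [Set.mem_preimage, Set.mem_ofPred_eq, this]
    · exact e.symm.measurable hL.measurableSet
  have hseg : IsCompact (segment ℝ 0 (Pi.single 0 1 : Fin (n+1) → ℝ) + K) :=
    (isCompact_zero_segment _).add hK
  have htail : Continuous (fun x : Fin (n+1) → ℝ => (Fin.tail x : Fin n → ℝ)) := by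
    unfold Fin.tail; fun_prop
  have hP : MeasurableSet ((fun x : Fin (n+1) → ℝ => (Fin.tail x : Fin n → ℝ)) '' K) :=
    (hK.image htail).measurableSet
  rw [hcomp _ hseg, hcomp _ hK]
  have hfib : ∀ y : Fin n → ℝ,
      volume {t : ℝ | (Fin.cons t y : Fin (n+1) → ℝ) ∈ segment ℝ 0 (Pi.single 0 1 : Fin (n+1) → ℝ) + K}
      = volume {t : ℝ | (Fin.cons t y : Fin (n+1) → ℝ) ∈ K}
        + ((fun x : Fin (n+1) → ℝ => (Fin.tail x : Fin n → ℝ)) '' K).indicator 1 y := by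
    intro y
    set S := {t : ℝ | (Fin.cons t y : Fin (n+1) → ℝ) ∈ K} with hS
    have hset : {t : ℝ | (Fin.cons t y : Fin (n+1) → ℝ) ∈
        segment ℝ 0 (Pi.single 0 1 : Fin (n+1) → ℝ) + K} = Set.Icc (0:ℝ) 1 + S := by
      ext t
      simp only [Set.mem_ofPred_eq, segment_eq_image', Set.mem_add, hS, Set.mem_image]
      constructor
      · rintro ⟨_, ⟨r, hr, rfl⟩, z, hz, hzt⟩
        refine ⟨r, hr, z 0, ?_, ?_⟩
        · convert hz using 1
          ext j
          refine Fin.cases ?_ (fun j => ?_) j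
          · simp
          · have := congrFun hzt j.succ
            simp at this
            simp [this]
        · have := congrFun hzt 0
          simpa using this
      · rintro ⟨r, hr, u, hu, rfl⟩
        refine ⟨_, ⟨r, hr, rfl⟩, _, hu, ?_⟩
        ext j
        refine Fin.cases ?_ (fun j => ?_) j <;> simp
    rw [hset]
    by_cases hne : S.Nonempty
    · have hmem : y ∈ ((fun x : Fin (n+1) → ℝ => (Fin.tail x : Fin n → ℝ)) '' K) := by
        obtain ⟨t, ht⟩ := hne
        exact ⟨_, ht, by simp⟩
      rw [Set.indicator_of_mem hmem, Pi.one_apply]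
      refine volume_compact_convex_add_Icc ?_ ?_ hne
      · have hcl : IsClosed S := hK.isClosed.preimage (by
          refine continuous_pi fun j => ?_
          refine Fin.cases ?_ (fun j => ?_) j
          · simpa using continuous_id'
          · simpa using continuous_const)
        have hb : S ⊆ (fun x : Fin (n+1) → ℝ => x 0) '' K := fun t ht => ⟨_, ht, by simp⟩
        exact (hK.image (by fun_prop)).of_isClosed_subset hcl hb
      · intro s hs t ht a b ha hb hab
        have := hc hs ht ha hb hab
        show (Fin.cons _ y : Fin (n+1) → ℝ) ∈ K
        convert this using 1
        ext j
        refine Fin.cases ?_ (fun j => ?_) j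
        · simp
        · simp [← add_mul, hab]
    · have hmem : y ∉ ((fun x : Fin (n+1) → ℝ => (Fin.tail x : Fin n → ℝ)) '' K) := by
        rintro ⟨x, hx, rfl⟩
        exact hne ⟨x 0, by simpa [hS] using hx⟩
      rw [Set.indicator_of_notMem hmem, Set.not_nonempty_iff_eq_empty.1 hne]
      simp
  simp_rw [hfib]
  rw [lintegral_add_right _ (measurable_one.indicator hP), lintegral_indicator_one hP]

/-- combinatorial expansion -/
lemma sum_piFinset_insert {ι : Type*} [DecidableEq ι] {n : ℕ} (G : (Fin (n+1) → ι) → ℝ)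
    (hG : ∀ f, ¬ Function.Injective f → G f = 0) {a : ι} {s : Finset ι} (ha : a ∉ s) :
    ∑ f ∈ Fintype.piFinset (fun _ : Fin (n+1) => insert a s), G f
      = ∑ f ∈ Fintype.piFinset (fun _ : Fin (n+1) => s), G f
        + ∑ p : Fin (n+1), ∑ g ∈ Fintype.piFinset (fun _ : Fin n => s),
            G (p.insertNth a g) := by
  rw [← Finset.sum_filter_add_sum_filter_not
    (Fintype.piFinset (fun _ : Fin (n+1) => insert a s)) (fun f => ∀ i, f i ≠ a)]
  congr 1
  · refine Finset.sum_congr ?_ fun _ _ => rfl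
    ext f
    simp only [Finset.mem_filter, Fintype.mem_piFinset, Finset.mem_insert]
    constructor
    · rintro ⟨h1, h2⟩ i
      exact (h1 i).resolve_left (h2 i)
    · intro h
      exact ⟨fun i => Or.inr (h i), fun i hi => ha (hi ▸ h i)⟩
  · rw [← Finset.sum_product']
    symm
    refine Finset.sum_bij_ne_zero (fun x _ _ => x.1.insertNth a x.2) ?_ ?_ ?_ ?_
    · rintro ⟨p, g⟩ h _
      simp only [Finset.mem_product, Finset.mem_univ, true_and, Fintype.mem_piFinset] at h
      simp only [Finset.mem_filter, Fintype.mem_piFinset, Finset.mem_insert]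
      refine ⟨?_, fun hh => hh p (by simp)⟩
      intro i
      refine Fin.succAboveCases p ?_ (fun i => ?_) i
      · simp
      · simp [h i]
    · rintro ⟨p, g⟩ h _ ⟨q, g'⟩ h' _ heq
      simp only [Finset.mem_product, Finset.mem_univ, true_and, Fintype.mem_piFinset] at h h'
      have hpq : p = q := by
        by_contra hne
        obtain ⟨k, hk⟩ := Fin.exists_succAbove_eq hne
        have := congrFun heq p
        simp only [Fin.insertNth_apply_same] at this
        rw [← hk] at this
        simp only [Fin.insertNth_apply_succAbove] at this
        exact ha (this ▸ h' k)
      subst hpq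
      have : g = g' := by
        ext i
        have := congrFun heq (p.succAbove i)
        simpa using this
      rw [this]
    · intro f hf hne
      simp only [Finset.mem_filter, Fintype.mem_piFinset, Finset.mem_insert, not_forall,
        not_not] at hf
      obtain ⟨h1, p, hp⟩ := hf
      have hinj : Function.Injective f := by
        by_contra h; exact hne (hG f h)
      have hfe : p.insertNth a (p.removeNth f) = f := by
        rw [← hp]; simp
      refine ⟨⟨p, p.removeNth f⟩, ?_, ?_, hfe⟩
      · simp only [Finset.mem_product, Finset.mem_univ, true_and, Fintype.mem_piFinset]
        intro i
        refine (h1 _).resolve_left fun h => ?_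
        exact Fin.succAbove_ne p i (hinj (h.trans hp.symm))
      · simpa [hfe] using hne
    · intros; rfl

lemma abs_det_insertNth {n : ℕ} (p : Fin (n+1)) (x : Fin (n+1) → ℝ)
    (w : Fin n → Fin (n+1) → ℝ) :
    |(Matrix.of (p.insertNth x w : Fin (n+1) → Fin (n+1) → ℝ)).det|
      = |(Matrix.of (Fin.cons x w : Fin (n+1) → Fin (n+1) → ℝ)).det| := by
  have h := Matrix.det_permute p.cycleRange.symm
    (Matrix.of (p.insertNth x w : Fin (n+1) → Fin (n+1) → ℝ))
  have h2 : (Matrix.of (p.insertNth x w : Fin (n+1) → Fin (n+1) → ℝ)).submatrix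
      p.cycleRange.symm id = Matrix.of (Fin.cons x w : Fin (n+1) → Fin (n+1) → ℝ) := by
    rw [← Fin.insertNth_comp_cycleRange_symm]
    rfl
  rw [← h2, h, abs_mul]
  rcases Int.units_eq_one_or (Equiv.Perm.sign p.cycleRange.symm) with h | h <;> simp [h]

lemma det_of_map {n : ℕ} (A : (Fin n → ℝ) →ₗ[ℝ] (Fin n → ℝ)) (w : Fin n → Fin n → ℝ) :
    (Matrix.of (fun i => A (w i))).det = LinearMap.det A * (Matrix.of w).det := by
  have : (Matrix.of (fun i => A (w i))) = Matrix.of w * (LinearMap.toMatrix' A).transpose := by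
    ext i j
    have := congrFun (LinearMap.toMatrix'_mulVec A (w i)) j
    simp only [Matrix.of_apply, Matrix.mul_apply, Matrix.transpose_apply]
    rw [← this, Matrix.mulVec, dotProduct]
    exact Finset.sum_congr rfl fun _ _ => mul_comm _ _
  rw [this, Matrix.det_mul, Matrix.det_transpose, LinearMap.det_toMatrix', mul_comm]

lemma det_cons_single {n : ℕ} (w : Fin n → Fin (n+1) → ℝ) :
    (Matrix.of (Fin.cons (Pi.single 0 1) w : Fin (n+1) → Fin (n+1) → ℝ)).det
      = (Matrix.of (fun i => (Fin.tail (w i) : Fin n → ℝ))).det := by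
  rw [Matrix.det_succ_row_zero, Finset.sum_eq_single 0]
  · simp only [Matrix.of_apply, Fin.cons_zero, Pi.single_eq_same, Fin.val_zero, pow_zero, one_mul]
    congr 1
  · intro b _ hb
    simp [hb]
  · simp

/-- Volume formula for zonotopes. -/
theorem zono_volume {ι : Type*} [DecidableEq ι] (n : ℕ) :
    ∀ (v : ι → (Fin n → ℝ)) (s : Finset ι),
    (n.factorial : ℝ) * volume.real (zono v s)
      = ∑ f ∈ Fintype.piFinset (fun _ : Fin n => s), |(Matrix.of (fun i => v (f i))).det| := by
  induction n with
  | zero =>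
    intro v s
    have : zono v s = Set.univ := by
      obtain ⟨x, hx⟩ := zono_nonempty v s
      exact Set.eq_univ_of_forall fun y => by rwa [Subsingleton.elim y x]
    rw [this]
    simp [Measure.real, volume_pi]
  | succ n ihn =>
    intro v s
    induction s using Finset.induction_on with
    | empty =>
      rw [zono_empty, Measure.real, measure_singleton]
      simp
    | insert a s ha ih =>
      rw [sum_piFinset_insert (fun f => |(Matrix.of (fun i => v (f i))).det|) ?_ ha, ← ih]
      · have hterm : ∀ (p : Fin (n+1)) (g : Fin n → ι),
            |(Matrix.of (fun i => v ((p.insertNth a g : Fin (n+1) → ι) i))).det|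
            = |(Matrix.of (Fin.cons (v a) (fun i => v (g i)) : Fin (n+1) → Fin (n+1) → ℝ)).det| := by
          intro p g
          rw [← abs_det_insertNth p]
          congr 3
          ext i : 1
          refine Fin.succAboveCases p ?_ (fun i => ?_) i <;> simp
        simp only [hterm, Finset.sum_const, Finset.card_univ, Fintype.card_fin]
        rw [zono_insert v ha]
        by_cases hv : v a = 0
        · have h0 : ∀ g : Fin n → ι,
            |(Matrix.of (Fin.cons (v a) (fun i => v (g i)) : Fin (n+1) → Fin (n+1) → ℝ)).det| = 0 := by
            intro g
            rw [abs_eq_zero]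
            exact Matrix.det_eq_zero_of_row_eq_zero 0 (fun j => by simp [hv])
          simp only [h0, Finset.sum_const_zero, smul_zero, add_zero]
          rw [hv, segment_same, Set.singleton_zero, zero_add]
        · obtain ⟨A, hA⟩ := SeparatingDual.exists_continuousLinearEquiv_apply_eq (R := ℝ)
            (x := (Pi.single 0 1 : Fin (n+1) → ℝ)) (y := v a) (by simp) hv
          set w : ι → Fin (n+1) → ℝ := fun i => A.symm (v i) with hw
          have hvw : v = fun i => A.toLinearEquiv.toLinearMap (w i) := by
            ext i : 1; simp [hw]
          have hwa : w a = Pi.single 0 1 := by simp [hw, ← hA]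
          set d := LinearMap.det A.toLinearEquiv.toLinearMap with hd
          have hK1 : zono v s = A.toLinearEquiv.toLinearMap '' zono w s := by
            rw [zono_image, ← hvw]
          have hK2 : segment ℝ 0 (v a) + zono v s =
              A.toLinearEquiv.toLinearMap '' (segment ℝ 0 (Pi.single 0 1) + zono w s) := by
            rw [← zono_insert v ha, ← hwa, ← zono_insert w ha, zono_image, ← hvw]
          have hdet : ∀ g : Fin n → ι,
              |(Matrix.of (Fin.cons (v a) (fun i => v (g i)) : Fin (n+1) → Fin (n+1) → ℝ)).det|
              = |d| * |(Matrix.of (fun i => (Fin.tail (w (g i)) : Fin n → ℝ))).det| := by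
            intro g
            rw [← det_cons_single, ← abs_mul, hd, ← det_of_map]
            congr 3
            ext i : 1
            refine Fin.cases ?_ (fun i => ?_) i <;> simp [hvw, hwa]
          simp only [hdet]
          rw [← Finset.mul_sum, ← ihn (fun i => Fin.tail (w i)) s]
          have ht : (fun x : Fin (n+1) → ℝ => (Fin.tail x : Fin n → ℝ)) '' zono w s
              = zono (fun i => (Fin.tail (w i) : Fin n → ℝ)) s :=
            zono_image (LinearMap.funLeft ℝ ℝ Fin.succ) w s
          have hvol := volume_add_segment (zono_isCompact w s) (zono_convex w s)
          rw [ht] at hvol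
          rw [hK2, hK1, Measure.real, Measure.real, Measure.addHaar_image_linearMap,
            Measure.addHaar_image_linearMap, hvol, ENNReal.toReal_mul, ENNReal.toReal_mul,
            ENNReal.toReal_add (zono_isCompact _ _).measure_lt_top.ne
              (zono_isCompact _ _).measure_lt_top.ne,
            ENNReal.toReal_ofReal (abs_nonneg _), Nat.factorial_succ, Measure.real]
          simp only [nsmul_eq_mul]
          push_cast
          ring
      · intro f hf
        rw [Function.Injective] at hf
        push Not at hf
        obtain ⟨i, j, hij, hne⟩ := hf
        rw [abs_eq_zero]
        exact Matrix.det_zero_of_row_eq hne (by ext k; simp [hij])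

lemma suppFn_bddAbove {n : ℕ} {A : Set (EuclideanSpace ℝ (Fin n))} (hA : IsCompact A)
    (ξ : EuclideanSpace ℝ (Fin n)) : BddAbove ((fun ζ => ⟪ζ, ξ⟫) '' A) :=
  (hA.image (by fun_prop)).bddAbove

lemma le_suppFn_s12 {n : ℕ} {A : Set (EuclideanSpace ℝ (Fin n))} (hA : IsCompact A)
    {x : EuclideanSpace ℝ (Fin n)} (hx : x ∈ A) (ξ : EuclideanSpace ℝ (Fin n)) :
    ⟪x, ξ⟫ ≤ suppFn A ξ :=
  le_csSup (suppFn_bddAbove hA ξ) ⟨x, hx, rfl⟩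

lemma suppFn_segment {n : ℕ} (y ξ : EuclideanSpace ℝ (Fin n)) :
    suppFn (segment ℝ 0 y) ξ = max ⟪y, ξ⟫ 0 := by
  apply le_antisymm
  · refine csSup_le (Set.Nonempty.image _ ⟨0, left_mem_segment _ _ _⟩) ?_
    rintro _ ⟨z, hz, rfl⟩
    rw [segment_eq_image'] at hz
    obtain ⟨t, ht, rfl⟩ := hz
    simp only [sub_zero, zero_add, inner_smul_left, RCLike.conj_to_real]
    rcases le_total 0 ⟪y, ξ⟫ with h | h
    · exact le_max_of_le_left (mul_le_of_le_one_left h ht.2)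
    · exact le_max_of_le_right (mul_nonpos_of_nonneg_of_nonpos ht.1 h)
  · refine max_le ?_ ?_
    · exact le_suppFn_s12 (isCompact_zero_segment y) (right_mem_segment _ _ _) ξ
    · simpa using le_suppFn_s12 (isCompact_zero_segment y) (left_mem_segment ℝ 0 y) ξ

lemma suppFn_add_s12 {n : ℕ} {A B : Set (EuclideanSpace ℝ (Fin n))} (hA : IsCompact A)
    (hB : IsCompact B) (hA' : A.Nonempty) (hB' : B.Nonempty) (ξ : EuclideanSpace ℝ (Fin n)) :
    suppFn (A + B) ξ = suppFn A ξ + suppFn B ξ := by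
  unfold suppFn
  rw [← csSup_add (hA'.image _) (suppFn_bddAbove hA ξ) (hB'.image _) (suppFn_bddAbove hB ξ)]
  congr 1
  ext r
  simp only [Set.mem_image, Set.mem_add]
  constructor
  · rintro ⟨_, ⟨a, ha, b, hb, rfl⟩, rfl⟩
    exact ⟨_, ⟨a, ha, rfl⟩, _, ⟨b, hb, rfl⟩, (inner_add_left _ _ _).symm⟩
  · rintro ⟨_, ⟨a, ha, rfl⟩, _, ⟨b, hb, rfl⟩, rfl⟩
    exact ⟨_, ⟨a, ha, b, hb, rfl⟩, inner_add_left _ _ _⟩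

lemma suppFn_zono {ι : Type*} {n : ℕ} (v : ι → EuclideanSpace ℝ (Fin n)) (s : Finset ι)
    (ξ : EuclideanSpace ℝ (Fin n)) : suppFn (zono v s) ξ = ∑ i ∈ s, max ⟪v i, ξ⟫ 0 := by
  classical
  induction s using Finset.induction_on with
  | empty => rw [zono_empty]; simp [suppFn]
  | insert a s h ih =>
    rw [zono_insert v h, suppFn_add_s12 (isCompact_zero_segment _) (zono_isCompact v s)
      ⟨0, left_mem_segment _ _ _⟩ (zono_nonempty v s), ih, suppFn_segment, Finset.sum_insert h]

lemma exists_suppFn_lt {n : ℕ} {A : Set (EuclideanSpace ℝ (Fin n))} (hA : IsCompact A)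
    (hc : Convex ℝ A) (hne : A.Nonempty) {x : EuclideanSpace ℝ (Fin n)} (hx : x ∉ A) :
    ∃ ξ : EuclideanSpace ℝ (Fin n), ξ ≠ 0 ∧ suppFn A ξ < ⟪x, ξ⟫ := by
  obtain ⟨f, u, h1, h2⟩ := geometric_hahn_banach_closed_point hc hA.isClosed hx
  set ξ := (InnerProductSpace.toDual ℝ (EuclideanSpace ℝ (Fin n))).symm f with hξ
  have hf : ∀ z, ⟪z, ξ⟫ = f z := by
    intro z
    rw [real_inner_comm, hξ, InnerProductSpace.toDual_symm_apply]
  refine ⟨ξ, ?_, ?_⟩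
  · intro h0
    obtain ⟨a, ha⟩ := hne
    have h3 := h1 a ha
    rw [← hf, h0] at h2 h3
    simp at h2 h3
    linarith
  · refine lt_of_le_of_lt (csSup_le (hne.image _) ?_) (by rw [hf]; exact h2)
    rintro _ ⟨a, ha, rfl⟩
    simp only [hf]
    exact (h1 a ha).le

/-- Continuity of volume along convergence of support functions. -/
lemma tendsto_volume_of_suppFn {n : ℕ} (Zk : ℕ → Set (EuclideanSpace ℝ (Fin n)))
    (Z : Set (EuclideanSpace ℝ (Fin n)))
    (hk : ∀ k, IsCompact (Zk k)) (hkc : ∀ k, Convex ℝ (Zk k)) (hkn : ∀ k, (Zk k).Nonempty)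
    (hZ : IsCompact Z) (hZc : Convex ℝ Z) (hZn : Z.Nonempty)
    (ε : ℕ → ℝ) (hε : Tendsto ε atTop (𝓝 0))
    (h : ∀ k ξ, |suppFn (Zk k) ξ - suppFn Z ξ| ≤ ε k * ‖ξ‖) :
    Tendsto (fun k => volume.real (Zk k)) atTop (𝓝 (volume.real Z)) := by
  have hind : ∀ S : Set (EuclideanSpace ℝ (Fin n)), IsCompact S →
      volume.real S = ∫ x, S.indicator (fun _ => (1:ℝ)) x := by
    intro S hS
    rw [integral_indicator hS.measurableSet]
    simp
  obtain ⟨R, hR⟩ := hZ.isBounded.exists_norm_le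
  have hRZ : ∀ ξ, suppFn Z ξ ≤ R * ‖ξ‖ := by
    intro ξ
    refine csSup_le (hZn.image _) ?_
    rintro _ ⟨a, ha, rfl⟩
    exact (real_inner_le_norm _ _).trans (by gcongr; exact hR a ha)
  simp only [hind _ hZ, fun k => hind _ (hk k)]
  refine tendsto_integral_filter_of_dominated_convergence
    ((Metric.closedBall 0 (R+1)).indicator (fun _ => (1:ℝ))) ?_ ?_ ?_ ?_
  · exact Eventually.of_forall fun k =>
      (measurable_const.indicator (hk k).measurableSet).aestronglyMeasurable
  · filter_upwards [hε.eventually (gt_mem_nhds (zero_lt_one (α := ℝ)))] with k hk1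
    refine Eventually.of_forall fun x => ?_
    rw [Real.norm_of_nonneg (Set.indicator_nonneg (fun _ _ => zero_le_one) x)]
    refine Set.indicator_le_indicator_of_subset ?_ (fun _ => zero_le_one) x
    intro x hx
    rw [mem_closedBall_zero_iff]
    have h1 := le_suppFn_s12 (hk k) hx x
    have h2 := (abs_le.1 (h k x)).2
    have h3 := hRZ x
    rw [real_inner_self_eq_norm_sq] at h1
    by_contra hcon
    push Not at hcon
    have hR1 : 0 ≤ R := by
      obtain ⟨a, ha⟩ := hZn
      exact (norm_nonneg a).trans (hR a ha)
    nlinarith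
  · rw [integrable_indicator_iff measurableSet_closedBall]
    exact integrableOn_const (isCompact_closedBall _ _).measure_lt_top.ne
  · have hfr : ∀ᵐ x : EuclideanSpace ℝ (Fin n), x ∉ frontier Z := by
      rw [ae_iff]
      simpa using hZc.addHaar_frontier volume
    filter_upwards [hfr] with x hx
    by_cases hxZ : x ∈ Z
    · have hint : x ∈ interior Z := by
        by_contra hni
        exact hx ⟨subset_closure hxZ, hni⟩
      obtain ⟨r, hr, hball⟩ := Metric.mem_nhds_iff.1 (mem_interior_iff_mem_nhds.1 hint)
      refine tendsto_const_nhds.congr' ?_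
      filter_upwards [hε.eventually (gt_mem_nhds (half_pos hr))] with k hk1
      have : x ∈ Zk k := by
        by_contra hnot
        obtain ⟨ξ, hξ0, hξ⟩ := exists_suppFn_lt (hk k) (hkc k) (hkn k) hnot
        have hpos : 0 < ‖ξ‖ := norm_pos_iff.2 hξ0
        have hy : x + (r / 2 / ‖ξ‖) • ξ ∈ Z := by
          apply hball
          rw [Metric.mem_ball, dist_eq_norm, add_sub_cancel_left, norm_smul, Real.norm_eq_abs,
            abs_of_pos (by positivity)]
          field_simp
          linarith
        have h1 := le_suppFn_s12 hZ hy ξ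
        rw [inner_add_left, real_inner_smul_left, real_inner_self_eq_norm_sq] at h1
        have h2 := (abs_le.1 (h k ξ)).1
        have h3 : r / 2 / ‖ξ‖ * ‖ξ‖ ^ 2 = r / 2 * ‖ξ‖ := by field_simp
        nlinarith
      rw [Set.indicator_of_mem this, Set.indicator_of_mem hxZ]
    · obtain ⟨ξ, hξ0, hξ⟩ := exists_suppFn_lt hZ hZc hZn hxZ
      have hlim : Tendsto (fun k => suppFn Z ξ + ε k * ‖ξ‖) atTop (𝓝 (suppFn Z ξ)) := by
        simpa using (hε.mul_const ‖ξ‖).const_add (suppFn Z ξ)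
      refine tendsto_const_nhds.congr' ?_
      filter_upwards [hlim.eventually (gt_mem_nhds hξ)] with k hk1
      have : x ∉ Zk k := by
        intro hmem
        have h1 := le_suppFn_s12 (hk k) hmem ξ
        have h2 := (abs_le.1 (h k ξ)).2
        linarith
      rw [Set.indicator_of_notMem this, Set.indicator_of_notMem hxZ]

/-- Zonotope volume in Euclidean space. -/
lemma zono_volume_euclidean {ι : Type*} [DecidableEq ι] {n : ℕ}
    (v : ι → EuclideanSpace ℝ (Fin n)) (s : Finset ι) :
    (n.factorial : ℝ) * volume.real (zono v s)
      = ∑ f ∈ Fintype.piFinset (fun _ : Fin n => s),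
          |(Matrix.of (fun i j => v (f i) j)).det| := by
  have h := zono_volume n (fun i => WithLp.ofLp (v i)) s
  have himg : zono (fun i => WithLp.ofLp (v i)) s
      = (WithLp.linearEquiv 2 ℝ (Fin n → ℝ)).toLinearMap '' zono v s := by
    rw [zono_image]; rfl
  have hvol : volume (zono (fun i => WithLp.ofLp (v i)) s) = volume (zono v s) := by
    rw [himg, ← (PiLp.volume_preserving_toLp (Fin n)).measure_preimage
      (zono_isCompact v s).measurableSet.nullMeasurableSet]
    congr 1
    ext x
    simp only [Set.mem_image, Set.mem_preimage]
    constructor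
    · rintro ⟨y, hy, rfl⟩
      simpa using hy
    · intro hx
      exact ⟨_, hx, by simp⟩
  rw [Measure.real, hvol] at h
  exact h

lemma integral_simple_det {n : ℕ}
    (ν : Measure (EuclideanSpace ℝ (Fin n))) [IsProbabilityMeasure ν]
    (φ : SimpleFunc (EuclideanSpace ℝ (Fin n)) (EuclideanSpace ℝ (Fin n)))
    (D : (Fin n → EuclideanSpace ℝ (Fin n)) → ℝ) :
    ∫ v : Fin n → EuclideanSpace ℝ (Fin n), D (fun i => φ (v i)) ∂(Measure.pi fun _ => ν)
      = ∑ f ∈ Fintype.piFinset (fun _ : Fin n => φ.range),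
          (∏ i, ν.real (φ ⁻¹' {f i})) * D f := by
  classical
  have hpt : ∀ v : Fin n → EuclideanSpace ℝ (Fin n), D (fun i => φ (v i))
      = ∑ f ∈ Fintype.piFinset (fun _ : Fin n => φ.range),
          (∏ i, (φ ⁻¹' {f i}).indicator (fun _ => (1:ℝ)) (v i)) * D f := by
    intro v
    rw [Finset.sum_eq_single (fun i => φ (v i))]
    · simp
    · intro f _ hne
      have : ∃ i, φ (v i) ≠ f i := by
        by_contra hcon
        push Not at hcon
        exact hne (funext fun i => (hcon i).symm)
      obtain ⟨i, hi⟩ := this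
      rw [Finset.prod_eq_zero (Finset.mem_univ i), zero_mul]
      simp [hi]
    · intro hnot
      exact absurd (Fintype.mem_piFinset.2 fun i => φ.mem_range_self _) hnot
  simp_rw [hpt]
  have hint : ∀ f : Fin n → EuclideanSpace ℝ (Fin n), ∀ i,
      Integrable ((φ ⁻¹' {f i}).indicator (fun _ => (1:ℝ))) ν := fun f i =>
    (integrable_const (1:ℝ)).indicator (φ.measurableSet_fiber _)
  rw [integral_finsetSum]
  · refine Finset.sum_congr rfl fun f _ => ?_
    rw [integral_mul_const, integral_fintype_prod_eq_prod]
    congr 1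
    refine Finset.prod_congr rfl fun i _ => ?_
    rw [integral_indicator (φ.measurableSet_fiber _)]
    simp
  · intro f _
    exact (Integrable.fintype_prod (hint f)).mul_const _

lemma abs_det_le {n : ℕ} (v : Fin n → EuclideanSpace ℝ (Fin n)) :
    |(Matrix.of (fun i j => v i j)).det| ≤ n.factorial * ∏ i, ‖v i‖ := by
  rw [Matrix.det_apply]
  refine (Finset.abs_sum_le_sum_abs _ _).trans ?_
  have : ∀ σ : Equiv.Perm (Fin n), σ ∈ Finset.univ →
      |Equiv.Perm.sign σ • ∏ i, (Matrix.of (fun i j => v i j)) (σ i) i| ≤ ∏ i, ‖v i‖ := by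
    intro σ _
    have : |Equiv.Perm.sign σ • ∏ i, (Matrix.of (fun i j => v i j)) (σ i) i|
        = ∏ i, |v (σ i) i| := by
      rcases Int.units_eq_one_or (Equiv.Perm.sign σ) with h | h <;> simp [h, Finset.abs_prod]
    rw [this, ← Equiv.prod_comp σ (fun i => ‖v i‖)]
    refine Finset.prod_le_prod (fun _ _ => abs_nonneg _) fun i _ => ?_
    exact PiLp.norm_apply_le (v (σ i)) i
  refine (Finset.sum_le_card_nsmul _ _ _ this).trans ?_
  simp [Fintype.card_perm]

theorem vitale_random_determinant {n : ℕ}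
    (ν : Measure (EuclideanSpace ℝ (Fin n))) [IsProbabilityMeasure ν]
    (hmom : Integrable (fun y => ‖y‖) ν)
    (Z : ConvexBody (EuclideanSpace ℝ (Fin n)))
    (hZ : ∀ ξ, suppFn (Z : Set (EuclideanSpace ℝ (Fin n))) ξ
      = ∫ y, suppFn (segment ℝ 0 y) ξ ∂ν) :
    (∫ v : Fin n → EuclideanSpace ℝ (Fin n),
        |(Matrix.of fun i j => v j i : Matrix (Fin n) (Fin n) ℝ).det|
        ∂(Measure.pi fun _ => ν))
      = (Nat.factorial n : ℝ) * (volume (Z : Set (EuclideanSpace ℝ (Fin n)))).toReal := by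
  classical
  set D : (Fin n → EuclideanSpace ℝ (Fin n)) → ℝ :=
    fun v => |(Matrix.of (fun i j => v i j)).det| with hD
  have hDeq : ∀ v : Fin n → EuclideanSpace ℝ (Fin n),
      |(Matrix.of fun i j => v j i : Matrix (Fin n) (Fin n) ℝ).det| = D v := by
    intro v
    rw [hD]
    simp only
    rw [← Matrix.det_transpose]
    rfl
  simp_rw [hDeq]
  have hDc : Continuous D := by
    rw [hD]
    refine (Continuous.matrix_det ?_).abs
    refine continuous_matrix fun i j => ?_
    simp only [Matrix.of_apply]
    fun_prop
  set φ : ℕ → SimpleFunc (EuclideanSpace ℝ (Fin n)) (EuclideanSpace ℝ (Fin n)) :=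
    SimpleFunc.approxOn id measurable_id Set.univ 0 (Set.mem_univ _) with hφ
  have hφle : ∀ k y, ‖φ k y‖ ≤ ‖y‖ + ‖y‖ := fun k y =>
    SimpleFunc.norm_approxOn_zero_le measurable_id (Set.mem_univ _) y k
  have hφt : ∀ y, Tendsto (fun k => φ k y) atTop (𝓝 y) := fun y =>
    SimpleFunc.tendsto_approxOn measurable_id (Set.mem_univ _) (by simp)
  have hφm : ∀ k, AEStronglyMeasurable (φ k) ν := fun k => (φ k).aestronglyMeasurable
  have hidi : Integrable (fun y : EuclideanSpace ℝ (Fin n) => y) ν :=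
    (integrable_norm_iff (by fun_prop)).1 hmom
  have hφi : ∀ k, Integrable (φ k) ν := fun k => SimpleFunc.integrable_of_isFiniteMeasure _
  -- L¹ errors
  set ε : ℕ → ℝ := fun k => ∫ y, ‖φ k y - y‖ ∂ν with hεdef
  have hε : Tendsto ε atTop (𝓝 0) := by
    have : Tendsto ε atTop (𝓝 (∫ _y : EuclideanSpace ℝ (Fin n), (0:ℝ) ∂ν)) := by
      refine tendsto_integral_of_dominated_convergence (fun y => 3 * ‖y‖) ?_ ?_ ?_ ?_
      · exact fun k => ((hφi k).sub hidi).norm.aestronglyMeasurable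
      · exact hmom.const_mul 3
      · refine fun k => Eventually.of_forall fun y => ?_
        rw [norm_norm]
        have := norm_sub_le (φ k y) y
        have := hφle k y
        linarith
      · refine Eventually.of_forall fun y => ?_
        simpa using ((hφt y).sub_const y).norm
    simpa using this
  -- zonotopes
  set p : ℕ → EuclideanSpace ℝ (Fin n) → ℝ := fun k y => ν.real (φ k ⁻¹' {y}) with hp
  set Zk : ℕ → Set (EuclideanSpace ℝ (Fin n)) :=
    fun k => zono (fun y => p k y • y) (φ k).range with hZk
  have hsupp : ∀ k ξ, suppFn (Zk k) ξ = ∫ y, max ⟪φ k y, ξ⟫ 0 ∂ν := by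
    intro k ξ
    rw [hZk]
    simp only
    rw [suppFn_zono]
    have h1 := SimpleFunc.map_integral (μ := ν) (φ k)
      (fun y : EuclideanSpace ℝ (Fin n) => max ⟪y, ξ⟫ 0) (hφi k) (by simp)
    have h2 := SimpleFunc.integral_eq_integral (μ := ν)
      ((φ k).map (fun y : EuclideanSpace ℝ (Fin n) => max ⟪y, ξ⟫ 0))
      (SimpleFunc.integrable_of_isFiniteMeasure _)
    rw [h1] at h2
    refine Eq.trans ?_ h2
    refine Finset.sum_congr rfl fun y _ => ?_
    rw [real_inner_smul_left, smul_eq_mul, mul_max_of_nonneg _ _ measureReal_nonneg, mul_zero]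
  have hmaxi : ∀ (g : EuclideanSpace ℝ (Fin n) → EuclideanSpace ℝ (Fin n)) ξ, Integrable g ν →
      Integrable (fun y => max ⟪g y, ξ⟫ 0) ν := by
    intro g ξ hg
    exact (hg.inner_const ξ).pos_part
  have hdiff : ∀ k ξ, |suppFn (Zk k) ξ - suppFn (Z : Set (EuclideanSpace ℝ (Fin n))) ξ|
      ≤ ε k * ‖ξ‖ := by
    intro k ξ
    rw [hsupp, hZ]
    simp_rw [suppFn_segment]
    rw [← integral_sub (hmaxi _ ξ (hφi k)) (hmaxi _ ξ hidi), hεdef]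
    simp only
    rw [← integral_mul_const]
    refine (abs_integral_le_integral_abs).trans ?_
    refine integral_mono (((hmaxi _ ξ (hφi k)).sub (hmaxi _ ξ hidi)).abs)
      ((((hφi k).sub hidi).norm).mul_const _) fun y => ?_
    refine (abs_max_sub_max_le_abs _ _ _).trans ?_
    rw [← inner_sub_left]
    exact abs_real_inner_le_norm _ _
  have hvol := tendsto_volume_of_suppFn Zk Z (fun k => zono_isCompact _ _)
    (fun k => zono_convex _ _) (fun k => zono_nonempty _ _) Z.isCompact Z.convex Z.nonempty
    ε hε hdiff
  have hk : ∀ k, (n.factorial : ℝ) * volume.real (Zk k)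
      = ∫ v, D (fun i => φ k (v i)) ∂(Measure.pi fun _ => ν) := by
    intro k
    rw [integral_simple_det, zono_volume_euclidean]
    refine Finset.sum_congr rfl fun f _ => ?_
    have h1 := Matrix.det_mul_column (fun i => p k (f i)) (Matrix.of (fun i j => f i j))
    have h2 : (Matrix.of (fun i j => (p k (f i) • f i) j)) =
        Matrix.of (fun i j => p k (f i) * (Matrix.of (fun i j => f i j)) i j) := by
      ext i j
      simp
    rw [h2, h1, abs_mul, abs_of_nonneg (Finset.prod_nonneg fun i _ => measureReal_nonneg)]
  have hdet : Tendsto (fun k => ∫ v, D (fun i => φ k (v i)) ∂(Measure.pi fun _ => ν)) atTop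
      (𝓝 (∫ v, D v ∂(Measure.pi fun _ => ν))) := by
    refine tendsto_integral_of_dominated_convergence
      (fun v => n.factorial * ∏ i, (2 * ‖v i‖)) ?_ ?_ ?_ ?_
    · intro k
      refine (hDc.measurable.comp ?_).aestronglyMeasurable
      exact measurable_pi_lambda _ fun i => (φ k).measurable.comp (measurable_pi_apply i)
    · exact (Integrable.fintype_prod (f := fun _ y => 2 * ‖y‖)
        (fun _ => hmom.const_mul 2)).const_mul _
    · refine fun k => Eventually.of_forall fun v => ?_
      rw [Real.norm_of_nonneg (abs_nonneg _)]
      refine (abs_det_le _).trans ?_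
      gcongr with i
      have := hφle k (v i)
      linarith
    · refine Eventually.of_forall fun v => ?_
      exact (hDc.tendsto v).comp (tendsto_pi_nhds.2 fun i => hφt (v i))
  have hlim := hvol.const_mul (n.factorial : ℝ)
  simp_rw [hk] at hlim
  exact tendsto_nhds_unique hdet hlim
end
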